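/- arXiv:1703.08086 — 4 statements merged into one kernel-verified Lean document; each statement's English description precedes it below -/
import Mathlib

section
/- Let q = p^r ≥ 3 be a prime power. Let f(x) and f(x) + c·x^k be permutation polynomials of F_q, where Crk(f) = n ≥ 1, f ∈ L₂, 1 ≤ k < q − 1, and c ∈ F_q*. Put m = gcd(k+1, q−1). Then k(n+3) + (k−1)(m−1)·√q ≥ q − n, where √q denotes the real square root of q. -/
/-- The map induced by `P_n(x) = (…((a₀x+a₁)^{q-2}+a₂)^{q-2}…+aₙ)^{q-2}+a_{n+1}`. -/
def carlitzMap {F : Type*} [Field F] (q : ℕ) (a : ℕ → F) : ℕ → F → F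
  | 0 => fun x => a 0 * x + a 1
  | n + 1 => fun x => (carlitzMap q a n x) ^ (q - 2) + a (n + 2)

/-- `a` gives a valid representation of `f` as `P_n` (so `a 0 ≠ 0` and `a i ≠ 0` for
`2 ≤ i ≤ n`, and `f c = P_n(c)` for all `c`). -/
def IsCarlitzRep {F : Type*} [Field F] (q : ℕ) (f : F → F) (n : ℕ) (a : ℕ → F) : Prop :=
  a 0 ≠ 0 ∧ (∀ i, 2 ≤ i → i ≤ n → a i ≠ 0) ∧ ∀ c, f c = carlitzMap q a n c

/-- The Carlitz rank of `f` is `n`: `n` is the least length of a representation of `f`. -/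
def HasCarlitzRank {F : Type*} [Field F] (q : ℕ) (f : F → F) (n : ℕ) : Prop :=
  IsLeast {m | ∃ a : ℕ → F, IsCarlitzRep q f m a} n

/-- `α_0 = 0`, `α_1 = a_0`, `α_k = a_k α_{k-1} + α_{k-2}`. -/
def carlitzAlpha {F : Type*} [Field F] (a : ℕ → F) : ℕ → F
  | 0 => 0
  | 1 => a 0
  | k + 2 => a (k + 2) * carlitzAlpha a (k + 1) + carlitzAlpha a k

/-- `β_0 = 1`, `β_1 = a_1`, `β_k = a_k β_{k-1} + β_{k-2}`. -/
def carlitzBeta {F : Type*} [Field F] (a : ℕ → F) : ℕ → F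
  | 0 => 1
  | 1 => a 1
  | k + 2 => a (k + 2) * carlitzBeta a (k + 1) + carlitzBeta a k

/-- `f ∈ L₁` (with Carlitz rank `n ≥ 1`): `f` admits a representation of length
`n = Crk(f)` with `α_n ≠ 0`. -/
def MemL1 {F : Type*} [Field F] (q : ℕ) (f : F → F) (n : ℕ) : Prop :=
  HasCarlitzRank q f n ∧ 1 ≤ n ∧
    ∃ a : ℕ → F, IsCarlitzRep q f n a ∧ carlitzAlpha a n ≠ 0

/-- `f ∈ L₂`: `f ∈ L₁` and the last pole `x_n = -β_n/α_n` equals `0`, i.e. `f` admits a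
representation of length `n = Crk(f)` with `α_n ≠ 0` and `β_n = 0`. -/
def MemL2 {F : Type*} [Field F] (q : ℕ) (f : F → F) (n : ℕ) : Prop :=
  HasCarlitzRank q f n ∧ 1 ≤ n ∧
    ∃ a : ℕ → F, IsCarlitzRep q f n a ∧ carlitzAlpha a n ≠ 0 ∧ carlitzBeta a n = 0

section

open Polynomial

theorem weighted_degree_injective {m k e U a a' j j' d d' : ℕ} (hmk : m.Coprime k)
    (hU : U + k ≤ e) (hj : j < m) (hj' : j' < m) (hd : d < U) (hd' : d' < U)
    (h : d + a * (m * e + 1) + j * e * k = d' + a' * (m * e + 1) + j' * e * k) :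
    a = a' ∧ j = j' := by
  have key : ∀ {a a' j j' d d' : ℕ}, j < m → j' < m → d < U → d' < U →
      d + a * (m * e + 1) + j * e * k = d' + a' * (m * e + 1) + j' * e * k →
      a * m + j * k ≤ a' * m + j' * k := by
    intro a a' j j' d d' hj hj' hd hd' h
    by_contra! hlt
    have h1 : (m * d + (m * e + 1) * (a * m + j * k) + j' * k : ℤ) =
        m * d' + (m * e + 1) * (a' * m + j' * k) + j * k := by
      have : (d + a * (m * e + 1) + j * e * k : ℤ) =
        d' + a' * (m * e + 1) + j' * e * k := by exact_mod_cast h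
      linear_combination (m : ℤ) * this
    have h2 : (a' * m + j' * k + 1 : ℤ) ≤ a * m + j * k := by exact_mod_cast hlt
    have h3 : (j * k : ℤ) ≤ m * k := by
      have : j * k ≤ m * k := Nat.mul_le_mul_right _ hj.le
      exact_mod_cast this
    have h4 : (m * d' + m * k : ℤ) ≤ m * e := by
      have : m * (d' + k) ≤ m * e := Nat.mul_le_mul_left _ (by omega)
      have : m * d' + m * k ≤ m * e := by linarith
      exact_mod_cast this
    have h5 : ((m * e + 1 : ℤ)) * (a' * m + j' * k + 1) ≤ (m * e + 1) * (a * m + j * k) :=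
      mul_le_mul_of_nonneg_left h2 (by positivity)
    have h6 : (0 : ℤ) ≤ m * d := by positivity
    have h7 : (0 : ℤ) ≤ j' * k := by positivity
    nlinarith
  have hs : a * m + j * k = a' * m + j' * k :=
    le_antisymm (key hj hj' hd hd' h) (key hj' hj hd' hd h.symm)
  have hjj : j = j' := by
    have h1 : j * k ≡ j' * k [MOD m] := by
      have h2 : a * m + j * k ≡ a' * m + j' * k [MOD m] := by rw [hs]
      simpa [Nat.ModEq, Nat.add_mod] using h2
    exact (Nat.ModEq.cancel_right_of_coprime hmk h1).eq_of_lt_of_lt hj hj'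
  subst hjj
  exact ⟨Nat.eq_of_mul_eq_mul_right (by omega : 0 < m) (by omega), rfl⟩

theorem sum_mul_X_pow_mul_pow_ne_zero {K : Type*} [Field K] {h : K[X]} (hh : h ≠ 0)
    {m e U I : ℕ} (hmk : m.Coprime h.natDegree) (hU : U + h.natDegree ≤ e)
    {u : Fin I × Fin m → K[X]} (hu : ∀ i, (u i).degree < U) (hne : u ≠ 0) :
    ∑ i, u i * X ^ (i.1.val * (m * e + 1)) * h ^ (i.2.val * e) ≠ 0 := by
  intro h0
  have hd := degree_sum_eq_of_disjoint
    (fun i => u i * X ^ (i.1.val * (m * e + 1)) * h ^ (i.2.val * e)) Finset.univ ?_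
  · rw [h0, degree_zero, eq_comm, Finset.sup_eq_bot_iff] at hd
    apply hne
    ext1 i
    have := hd i (Finset.mem_univ _)
    rw [degree_eq_bot] at this
    simpa [hh] using this
  · rintro i ⟨-, hi⟩ i' ⟨-, hi'⟩ hii hdeg
    apply hii
    have hui : u i ≠ 0 := by rintro h; simp [h] at hi
    have hui' : u i' ≠ 0 := by rintro h; simp [h] at hi'
    have h1 := natDegree_eq_of_degree_eq hdeg
    have hx (i) : (X : K[X]) ^ (i * (m * e + 1)) ≠ 0 := pow_ne_zero _ X_ne_zero
    simp only at h1
    rw [natDegree_mul (mul_ne_zero hui (hx _)) (pow_ne_zero _ hh), natDegree_mul hui (hx _),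
      natDegree_mul (mul_ne_zero hui' (hx _)) (pow_ne_zero _ hh), natDegree_mul hui' (hx _)] at h1
    simp only [natDegree_pow, natDegree_X, mul_one] at h1
    obtain ⟨h2, h3⟩ := weighted_degree_injective hmk hU i.2.2 i'.2.2
      ((natDegree_lt_iff_degree_lt hui).2 (hu i)) ((natDegree_lt_iff_degree_lt hui').2 (hu i')) h1
    exact Prod.ext (Fin.ext h2) (Fin.ext h3)

theorem exists_ne_zero_sum_pow_eq_zero {K : Type*} [Field K] [Fintype K] {p s : ℕ}
    [hp : Fact p.Prime] [CharP K p] {ι : Type*} [Fintype ι] (v : ι → K[X]) {U T : ℕ}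
    (hv : ∀ i, (v i).degree + ((p ^ s * U : ℕ) : WithBot ℕ) ≤ T) (hT : T < Fintype.card ι * U) :
    ∃ u : ι → K[X], (∀ i, (u i).degree < U) ∧ u ≠ 0 ∧ ∑ i, u i ^ p ^ s * v i = 0 := by
  classical
  have : ExpChar K p := ExpChar.prime hp.out
  have key : ∀ u : ι → degreeLT K U, ∑ i, (u i : K[X]) ^ p ^ s * v i ∈ degreeLT K T := by
    intro u
    refine Submodule.sum_mem _ fun i _ => ?_
    rw [mem_degreeLT]
    by_cases h0 : (u i : K[X]) = 0
    · rw [h0, zero_pow (pow_pos hp.out.pos _).ne', zero_mul, degree_zero]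
      exact WithBot.bot_lt_coe _
    by_cases h1 : v i = 0
    · rw [h1, mul_zero, degree_zero]
      exact WithBot.bot_lt_coe _
    have h2 := mem_degreeLT.1 (u i).2
    have h3 := hv i
    rw [degree_mul, degree_pow, degree_eq_natDegree h0, degree_eq_natDegree h1] at *
    have h2' : (u i : K[X]).natDegree < U := by exact_mod_cast h2
    have h3' : (v i).natDegree + p ^ s * U ≤ T := by exact_mod_cast h3
    have : p ^ s * (u i : K[X]).natDegree < p ^ s * U :=
      Nat.mul_lt_mul_of_pos_left h2' (pow_pos hp.out.pos _)
    have h4 : p ^ s * (u i : K[X]).natDegree + (v i).natDegree < T := by omega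
    rw [nsmul_eq_mul]
    exact_mod_cast h4
  let Φ : (ι → degreeLT K U) → degreeLT K T := fun u => ⟨_, key u⟩
  let eU (n : ℕ) := (degreeLTEquiv K n).toEquiv
  let (n : ℕ) : Fintype (degreeLT K n) := Fintype.ofEquiv _ (eU n).symm
  have hc (n : ℕ) : Fintype.card (degreeLT K n) = Fintype.card K ^ n := by
    rw [Fintype.card_congr (eU n)]; simp
  obtain ⟨a, b, hab, hΦ⟩ := Fintype.exists_ne_map_eq_of_card_lt Φ (by
    rw [hc, Fintype.card_fun, hc, ← pow_mul]
    exact Nat.pow_lt_pow_right Fintype.one_lt_card (by linarith))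
  refine ⟨fun i => (a i - b i : degreeLT K U), fun i => mem_degreeLT.1 (a i - b i).2, ?_, ?_⟩
  · intro h
    apply hab
    ext1 i
    have := congrFun h i
    simpa [sub_eq_zero] using this
  · have := congrArg Subtype.val hΦ
    simp only [Φ] at this
    simp only [Submodule.coe_sub, sub_pow_expChar_pow, sub_mul, Finset.sum_sub_distrib, this,
      sub_self]

theorem stepanov_card_le {K : Type*} [Field K] [Fintype K] [DecidableEq K] {p s : ℕ}
    [hp : Fact p.Prime] [CharP K p] (hcard : Fintype.card K = (p ^ s) ^ 2) {h : K[X]} (hh : h ≠ 0)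
    {m e k : ℕ}
    (hk : h.natDegree = k) (hm : 0 < m)
    (hmk : m.Coprime k) (he : p ^ s = m * e + 1) (hlarge : 2 * (m * k) + 5 ≤ e)
    {ζ : K} (hζ : ζ ≠ 0) :
    m * (Finset.univ.filter fun x : K => h.eval x ^ (e * (p ^ s + 1)) = ζ).card ≤
      (p ^ s) ^ 2 + m * (2 * (2 + m * k) + k) * p ^ s := by
  have hkm : k ≤ m * k := Nat.le_mul_of_pos_left k hm
  obtain ⟨U, hU⟩ : ∃ U, e = U + k := ⟨e - k, by omega⟩
  set I := e + 2 * (2 + m * k) with hI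
  set v : Fin I × Fin m → K[X] := fun i =>
    X ^ i.1.val * C (ζ ^ i.2.val) * h ^ ((m - 1 - i.2.val) * e)
  have hv : ∀ i, (v i).degree + ((p ^ s * U : ℕ) : WithBot ℕ) ≤
      ((p ^ s * U + I + m * e * k : ℕ) : WithBot ℕ) := by
    intro i
    have hz : C (ζ ^ i.2.val) ≠ 0 := by simpa using pow_ne_zero _ hζ
    have hx : (X : K[X]) ^ i.1.val ≠ 0 := pow_ne_zero _ X_ne_zero
    have hv0 : v i ≠ 0 := mul_ne_zero (mul_ne_zero hx hz) (pow_ne_zero _ hh)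
    have hvd : (v i).natDegree = i.1.val + (m - 1 - i.2.val) * e * k := by
      simp only [v]
      rw [natDegree_mul (mul_ne_zero hx hz) (pow_ne_zero _ hh), natDegree_mul hx hz]
      simp [hk]
    rw [degree_eq_natDegree hv0, hvd]
    have h1 : (m - 1 - i.2.val) * e * k ≤ m * e * k := by gcongr; omega
    have h2 := i.1.2
    exact_mod_cast (by omega :
      i.1.val + (m - 1 - i.2.val) * e * k + p ^ s * U ≤ p ^ s * U + I + m * e * k)
  obtain ⟨u, hu, hune, hu0⟩ := exists_ne_zero_sum_pow_eq_zero (p := p) (s := s) v hv (by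
    simp only [Fintype.card_prod, Fintype.card_fin]
    have h1 : p ^ s * U + I + m * e * k ≤ p ^ s * e + I := by
      rw [hU, he]
      nlinarith
    have h2 : p ^ s * e + I < I * m * U := by
      have h3 : p ^ s = m * U + m * k + 1 := by rw [he, hU]; ring
      have h4 : U ≤ m * U := Nat.le_mul_of_pos_left U hm
      rw [h3, hI, mul_assoc]
      generalize m * U = A at *
      have h5 : e + 2 < 2 * A := by omega
      nlinarith
    omega)
  set w := ∑ i, u i * X ^ (i.1.val * (m * e + 1)) * h ^ (i.2.val * e) with hw
  have hw0 : w ≠ 0 := sum_mul_X_pow_mul_pow_ne_zero hh (by rwa [hk]) (by rw [hk, hU]) hu hune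
  have hwd : m * w.natDegree ≤ (p ^ s) ^ 2 + m * (2 * (2 + m * k) + k) * p ^ s := by
    have h1 : w.natDegree ≤ e + I * p ^ s + p ^ s * k := by
      refine natDegree_sum_le_of_forall_le _ _ fun i _ => ?_
      refine natDegree_mul_le.trans
        (Nat.add_le_add (natDegree_mul_le.trans (Nat.add_le_add ?_ ?_)) ?_)
      · by_cases h0 : u i = 0
        · simp [h0]
        · have := (natDegree_lt_iff_degree_lt h0).2 (hu i)
          omega
      · rw [natDegree_X_pow, he]
        exact Nat.mul_le_mul_right _ i.1.2.le
      · rw [natDegree_pow, hk, he]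
        gcongr
        have := Nat.mul_le_mul_right e i.2.2.le
        omega
    calc m * w.natDegree ≤ m * (e + I * p ^ s + p ^ s * k) := Nat.mul_le_mul_left _ h1
      _ ≤ _ := by
        rw [hI, he]
        nlinarith
  refine le_trans (Nat.mul_le_mul_left _ ?_) hwd
  refine (Finset.card_le_card (t := w.roots.toFinset) ?_).trans
    ((Multiset.toFinset_card_le _).trans (card_roots' w))
  intro x hx
  rw [Finset.mem_filter] at hx
  have hx := hx.2
  have hhx : h.eval x ≠ 0 := by
    intro h0
    have : 0 < e := by omega
    rw [h0, zero_pow (by positivity)] at hx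
    exact hζ hx.symm
  rw [Multiset.mem_toFinset, mem_roots hw0, IsRoot.def]
  have hQ : x ^ (p ^ s * p ^ s) = x := by
    rw [← sq, ← hcard]; exact FiniteField.pow_card x
  have : ExpChar K p := ExpChar.prime hp.out
  have hmul : h.eval x ^ ((m - 1) * e) * (w.eval x) ^ p ^ s = 0 := by
    have h1 := congrArg (eval x) hu0
    rw [eval_zero] at h1
    rw [← h1, hw, eval_finsetSum, sum_pow_char_pow, Finset.mul_sum, eval_finsetSum]
    refine Finset.sum_congr rfl fun i _ => ?_
    simp only [v, eval_mul, eval_pow, eval_X, eval_C, ← he]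
    have h2 : h.eval x ^ ((m - 1) * e) =
        h.eval x ^ ((m - 1 - i.2.val) * e) * h.eval x ^ (i.2.val * e) := by
      rw [← pow_add, ← add_mul]
      congr 2
      have := i.2.2
      omega
    rw [h2, ← hx, mul_pow, mul_pow, ← pow_mul x, mul_assoc i.1.val, mul_comm i.1.val, pow_mul x, hQ]
    ring
  have := (mul_eq_zero.1 hmul).resolve_left (pow_ne_zero _ hhx)
  exact eq_zero_of_pow_eq_zero this

theorem exists_pow_eq_iff_and_mulChar_eq {K : Type*} [Field K] [Fintype K] {m M : ℕ} (hm : 0 < m)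
    (hM : m * M = Fintype.card K - 1) {ψ : MulChar K ℂ} (hψm : ψ ^ m = 1) {g : Kˣ}
    (hg : ∀ x, x ∈ Subgroup.zpowers g) {y : K} (hy : y ≠ 0) :
    ∃ i₀ < m, ψ y = ψ g ^ i₀ ∧ ∀ i < m, y ^ M = (g : K) ^ (i * M) ↔ i = i₀ := by
  classical
  have hω : ψ g ^ m = 1 := by
    rw [← MulChar.pow_apply_coe, hψm, MulChar.one_apply_coe]
  have hord : orderOf g = m * M := by
    rw [orderOf_eq_card_of_forall_mem_zpowers hg, Nat.card_eq_fintype_card, Fintype.card_units, hM]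
  have hMpos : 0 < M := by
    have := Fintype.one_lt_card (α := K)
    exact Nat.pos_of_mul_pos_left (by omega : 0 < m * M)
  obtain ⟨j, hj⟩ := (mem_powers_iff_mem_zpowers).2 (hg (Units.mk0 y hy))
  have hj' : (g : K) ^ j = y := by
    have := congrArg Units.val hj
    simpa using this
  refine ⟨j % m, Nat.mod_lt _ hm, ?_, fun i hi => ?_⟩
  · rw [← hj', map_pow, ← pow_mod_orderOf, ← pow_mod_orderOf _ (j % m), Nat.mod_mod_of_dvd]
    exact orderOf_dvd_of_pow_eq_one hω
  · rw [← hj', ← pow_mul]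
    have : (g : K) ^ (j * M) = (g : K) ^ (i * M) ↔ g ^ (j * M) = g ^ (i * M) := by
      rw [Units.ext_iff]; simp
    rw [this, pow_eq_pow_iff_modEq, hord]
    constructor
    · intro h
      have := Nat.ModEq.mul_right_cancel' hMpos.ne' h
      rw [Nat.ModEq, Nat.mod_eq_of_lt hi] at this
      exact this.symm
    · rintro rfl
      exact Nat.ModEq.mul_right' _ (Nat.mod_modEq _ _).symm

theorem norm_sum_mulChar_eval_le {K : Type*} [Field K] [Fintype K] {p s : ℕ}
    [hp : Fact p.Prime] [CharP K p] (hcard : Fintype.card K = (p ^ s) ^ 2) {h : K[X]} (hh : h ≠ 0)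
    {m e k : ℕ}
    (hk : h.natDegree = k) (hm : 0 < m)
    (hmk : m.Coprime k) (he : p ^ s = m * e + 1) (hlarge : 2 * (m * k) + 5 ≤ e)
    {ψ : MulChar K ℂ} (hψm : ψ ^ m = 1) (hψ : ψ ≠ 1) :
    ‖∑ x, ψ (h.eval x)‖ ≤ (m * (2 * (2 + m * k) + k) + k : ℕ) * (p ^ s : ℕ) := by
  classical
  obtain ⟨g, hg⟩ := IsCyclic.exists_generator (α := Kˣ)
  set M := e * (p ^ s + 1) with hMdef
  set ω := ψ g with hωdef
  have hω1 : ω ≠ 1 := by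
    intro h1
    apply hψ
    rw [MulChar.eq_iff hg, ← hωdef, h1, MulChar.one_apply_coe]
  have hωm : ω ^ m = 1 := by
    rw [hωdef, ← MulChar.pow_apply_coe, hψm, MulChar.one_apply_coe]
  have hωsum : ∑ i ∈ Finset.range m, ω ^ i = 0 := by
    have := geom_sum_mul ω m
    rw [hωm, sub_self] at this
    exact (mul_eq_zero.1 this).resolve_right (sub_ne_zero.2 hω1)
  have hωn : ‖ω‖ = 1 := Complex.norm_eq_one_of_pow_eq_one hωm hm.ne'
  have hM : m * M = Fintype.card K - 1 := by
    rw [hcard, hMdef, he]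
    refine Nat.eq_sub_of_add_eq ?_
    ring
  have hMpos : 0 < M := Nat.mul_pos (by omega) (by omega)
  set N : ℕ → ℕ := fun i =>
    (Finset.univ.filter fun x : K => h.eval x ^ M = (g : K) ^ (i * M)).card with hN
  have hN0 : ∀ x : K, h.eval x = 0 → ∀ i, ¬ h.eval x ^ M = (g : K) ^ (i * M) := by
    intro x hx i hxi
    rw [hx, zero_pow hMpos.ne'] at hxi
    exact pow_ne_zero _ g.ne_zero hxi.symm
  have hS : ∑ x, ψ (h.eval x) = ∑ i ∈ Finset.range m, ω ^ i * (N i : ℂ) := by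
    simp only [hN, Finset.card_filter, Nat.cast_sum, Finset.mul_sum]
    rw [Finset.sum_comm]
    refine Finset.sum_congr rfl fun x _ => ?_
    by_cases hx : h.eval x = 0
    · rw [hx, MulChar.map_zero, eq_comm]
      refine Finset.sum_eq_zero fun i _ => ?_
      rw [← hx, if_neg (hN0 x hx i)]
      simp
    · obtain ⟨i₀, hi₀, h1, h2⟩ := exists_pow_eq_iff_and_mulChar_eq hm hM hψm hg hx
      rw [h1, Finset.sum_eq_single_of_mem i₀ (Finset.mem_range.2 hi₀)]
      · rw [if_pos ((h2 i₀ hi₀).2 rfl)]; simp [hωdef]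
      · intro i hi hne
        rw [if_neg (mt (h2 i (Finset.mem_range.1 hi)).1 hne)]; simp
  have hNsum : (p ^ s) ^ 2 ≤ ∑ i ∈ Finset.range m, N i + k := by
    have h1 : ∑ i ∈ Finset.range m, N i = (Finset.univ.filter fun x : K => h.eval x ≠ 0).card := by
      simp only [hN, Finset.card_filter]
      rw [Finset.sum_comm]
      refine Finset.sum_congr rfl fun x _ => ?_
      by_cases hx : h.eval x = 0
      · rw [if_neg (by simpa using hx)]
        exact Finset.sum_eq_zero fun i _ => if_neg (hN0 x hx i)
      · obtain ⟨i₀, hi₀, -, h2⟩ := exists_pow_eq_iff_and_mulChar_eq hm hM hψm hg hx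
        rw [if_pos hx, Finset.sum_eq_single_of_mem i₀ (Finset.mem_range.2 hi₀)]
        · rw [if_pos ((h2 i₀ hi₀).2 rfl)]
        · intro i hi hne
          rw [if_neg (mt (h2 i (Finset.mem_range.1 hi)).1 hne)]
    have h2 : (Finset.univ.filter fun x : K => h.eval x = 0).card ≤ k := by
      rw [← hk]
      refine (Finset.card_le_card (t := h.roots.toFinset) fun x hx => ?_).trans
        ((Multiset.toFinset_card_le _).trans (card_roots' h))
      rw [Multiset.mem_toFinset, mem_roots hh]
      exact (Finset.mem_filter.1 hx).2
    have h3 := Finset.card_filter_add_card_filter_not (s := (Finset.univ : Finset K))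
      (fun x : K => h.eval x = 0)
    rw [Finset.card_univ, hcard] at h3
    rw [h1, ← h3, add_comm]
    exact Nat.add_le_add_left h2 _
  set B := (p ^ s) ^ 2 + m * (2 * (2 + m * k) + k) * p ^ s with hB
  have hNB : ∀ i, m * N i ≤ B := fun i =>
    stepanov_card_le hcard hh hk hm hmk he hlarge (pow_ne_zero _ g.ne_zero)
  have hmS : (m : ℂ) * ∑ x, ψ (h.eval x) =
      -∑ i ∈ Finset.range m, ω ^ i * ((B : ℂ) - m * N i) := by
    rw [hS]
    simp only [mul_sub, Finset.sum_sub_distrib, ← Finset.sum_mul, hωsum, Finset.mul_sum]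
    rw [zero_mul, zero_sub, neg_neg]
    exact Finset.sum_congr rfl fun i _ => by ring
  have hmS' : (m : ℝ) * ‖∑ x, ψ (h.eval x)‖ ≤ m * B - m * ∑ i ∈ Finset.range m, (N i : ℝ) := by
    have h1 := congrArg norm hmS
    rw [norm_mul, Complex.norm_natCast, norm_neg] at h1
    rw [h1]
    refine (norm_sum_le _ _).trans ?_
    have : ∀ i ∈ Finset.range m, ‖ω ^ i * ((B : ℂ) - m * N i)‖ = (B : ℝ) - m * N i := by
      intro i _
      rw [norm_mul, norm_pow, hωn, one_pow, one_mul]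
      have h2 : ((m * N i : ℕ) : ℝ) ≤ B := by exact_mod_cast hNB i
      push_cast at h2
      rw [← Real.norm_of_nonneg (sub_nonneg.2 h2), ← Complex.norm_real]
      push_cast
      rfl
    rw [Finset.sum_congr rfl this]
    simp [Finset.sum_sub_distrib, Finset.mul_sum]
  have hm' : (0 : ℝ) < m := by exact_mod_cast hm
  rw [← mul_sub] at hmS'
  have h1 := le_of_mul_le_mul_left hmS' hm'
  have h2 : (((p ^ s) ^ 2 : ℕ) : ℝ) ≤ ∑ i ∈ Finset.range m, (N i : ℝ) + k := by exact_mod_cast hNsum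
  have h3 : (k : ℝ) ≤ k * (p ^ s : ℕ) := by
    have : (1 : ℝ) ≤ (p ^ s : ℕ) := by exact_mod_cast Nat.one_le_pow _ _ hp.out.pos
    nlinarith [Nat.cast_nonneg (α := ℝ) k]
  rw [hB] at h1
  push_cast at h1 h2 h3 ⊢
  linarith

theorem norm_le_of_norm_sum_pow_le {Ω : Multiset ℂ} {ρ C : ℝ} {s₀ : ℕ} (hρ : 0 < ρ)
    (h : ∀ s, s₀ ≤ s → ‖(Ω.map fun l => l ^ s).sum‖ ≤ C * ρ ^ s) {μ : ℂ} (hμ : μ ∈ Ω) :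
    ‖μ‖ ≤ ρ := by
  classical
  set P : ℂ[X] := ∏ ν ∈ Ω.toFinset.erase μ, (X - Polynomial.C ν) with hP
  have hPμ : P.eval μ ≠ 0 := by
    rw [hP, eval_prod, Finset.prod_ne_zero_iff]
    intro ν hν
    simpa [sub_eq_zero] using (Finset.ne_of_mem_erase hν).symm
  have hP0 : ∀ l ∈ Ω, l ≠ μ → P.eval l = 0 := by
    intro l hl hne
    rw [hP, eval_prod]
    exact Finset.prod_eq_zero (Finset.mem_erase.2 ⟨hne, Multiset.mem_toFinset.2 hl⟩) (by simp)
  have h1 (s : ℕ) : (Ω.map fun l => l ^ s * P.eval l).sum = Ω.count μ * (μ ^ s * P.eval μ) := by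
    rw [Finset.sum_multiset_map_count, Finset.sum_eq_single μ, nsmul_eq_mul]
    · intro l hl hne
      rw [hP0 l (Multiset.mem_toFinset.1 hl) hne]; simp
    · intro hn; exact absurd (Multiset.mem_toFinset.2 hμ) hn
  have h2 (s : ℕ) : (Ω.map fun l => l ^ s * P.eval l).sum =
      ∑ i ∈ Finset.range (P.natDegree + 1), P.coeff i * (Ω.map fun l => l ^ (s + i)).sum := by
    simp only [← Multiset.sum_map_mul_left, eval_eq_sum_range, Finset.mul_sum]
    rw [← Multiset.sum_map_sum]
    refine congrArg Multiset.sum (Multiset.map_congr rfl fun l _ => ?_)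
    exact Finset.sum_congr rfl fun i _ => by ring
  set C' := ∑ i ∈ Finset.range (P.natDegree + 1), ‖P.coeff i‖ * (C * ρ ^ i)
  have h3 : ∀ s, s₀ ≤ s → ‖μ‖ ^ s * ‖P.eval μ‖ ≤ C' * ρ ^ s := by
    intro s hs
    have hcount : (1 : ℝ) ≤ Ω.count μ := by exact_mod_cast Multiset.count_pos.2 hμ
    have h4 := congrArg norm ((h1 s).symm.trans (h2 s))
    rw [norm_mul, norm_mul, norm_pow, Complex.norm_natCast] at h4
    calc ‖μ‖ ^ s * ‖P.eval μ‖ ≤ Ω.count μ * (‖μ‖ ^ s * ‖P.eval μ‖) :=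
          le_mul_of_one_le_left (by positivity) hcount
      _ ≤ ∑ i ∈ Finset.range (P.natDegree + 1), ‖P.coeff i‖ * (C * ρ ^ (s + i)) := by
          rw [h4]
          refine norm_sum_le_of_le _ fun i _ => ?_
          rw [norm_mul]
          exact mul_le_mul_of_nonneg_left (h _ (by omega)) (norm_nonneg _)
      _ = C' * ρ ^ s := by
          rw [Finset.sum_mul]
          exact Finset.sum_congr rfl fun i _ => by ring
  by_contra! hlt
  have h5 : 1 < ‖μ‖ / ρ := (one_lt_div hρ).2 hlt
  have hPn : 0 < ‖P.eval μ‖ := norm_pos_iff.2 hPμ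
  obtain ⟨n, hn⟩ := pow_unbounded_of_one_lt (C' / ‖P.eval μ‖) h5
  have h6 := h3 (max n s₀) (le_max_right _ _)
  have h7 := hn.trans_le (pow_le_pow_right₀ h5.le (le_max_left n s₀))
  rw [div_lt_iff₀ hPn, div_pow, div_mul_eq_mul_div, lt_div_iff₀ (by positivity)] at h7
  linarith

theorem exists_eq_prod_one_sub_C_mul_X {P : ℂ[X]} (hP : P.coeff 0 = 1) :
    ∃ Ω : Multiset ℂ, Ω.card = P.natDegree ∧ P = (Ω.map fun w => 1 - C w * X).prod := by
  have hs := IsAlgClosed.splits P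
  have hroot : ∀ r ∈ P.roots, r ≠ 0 := by
    rintro r hr rfl
    have := isRoot_of_mem_roots hr
    rw [IsRoot.def, ← coeff_zero_eq_eval_zero, hP] at this
    exact one_ne_zero this
  refine ⟨P.roots.map (·⁻¹), by rw [Multiset.card_map, hs.natDegree_eq_card_roots], ?_⟩
  have h1 : P = C (P.leadingCoeff * (P.roots.map (-·)).prod) *
      ((P.roots.map (·⁻¹)).map fun w => 1 - C w * X).prod := by
    conv_lhs => rw [hs.eq_prod_roots]
    rw [map_mul, mul_assoc, map_multiset_prod, Multiset.map_map, Multiset.map_map,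
      ← Multiset.prod_map_mul]
    congr 2
    refine Multiset.map_congr rfl fun r hr => ?_
    simp only [Function.comp]
    rw [mul_sub, ← mul_assoc, ← C_mul, neg_mul, mul_inv_cancel₀ (hroot r hr)]
    simp
    ring
  have h2 : P.leadingCoeff * (P.roots.map (-·)).prod = 1 := by
    have h3 := congrArg (eval 0) h1
    have h4 (Ω : Multiset ℂ) : eval 0 (Ω.map fun w => 1 - C w * X).prod = 1 := by
      simp [eval_multiset_prod]
    rw [← coeff_zero_eq_eval_zero, hP, eval_mul, eval_C, h4, mul_one] at h3
    exact h3.symm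
  rw [h2, C_1, one_mul] at h1
  exact h1

theorem X_mul_derivative_prod_one_sub_C_mul_X (Ω : Multiset ℂ) :
    ((X * derivative (Ω.map fun w => 1 - C w * X).prod : ℂ[X]) : PowerSeries ℂ) =
      -(((Ω.map fun w => 1 - C w * X).prod : ℂ[X]) : PowerSeries ℂ) *
        PowerSeries.mk fun r => if r = 0 then 0 else (Ω.map fun w => w ^ r).sum := by
  induction Ω using Multiset.induction_on with
  | empty =>
    simp
    ext
    simp
  | cons w Ω ih =>
    have hsplit : (PowerSeries.mk fun r => if r = 0 then 0 else ((w ::ₘ Ω).map fun w => w ^ r).sum)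
        = (PowerSeries.mk fun r => if r = 0 then 0 else w ^ r) +
          PowerSeries.mk fun r => if r = 0 then 0 else (Ω.map fun w => w ^ r).sum := by
      ext r
      simp only [PowerSeries.coeff_mk, map_add, Multiset.map_cons, Multiset.sum_cons]
      split_ifs <;> simp
    have hw : ((1 - C w * X : ℂ[X]) : PowerSeries ℂ) *
        (PowerSeries.mk fun r => if r = 0 then 0 else w ^ r) =
          ((C w * X : ℂ[X]) : PowerSeries ℂ) := by
      ext r
      rw [coe_sub, coe_mul, coe_C, coe_X, coe_one, sub_mul, one_mul, mul_assoc, map_sub,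
        PowerSeries.coeff_C_mul]
      rcases r with _ | _ | r
      · simp
      · simp [PowerSeries.coeff_succ_X_mul]
      · simp [PowerSeries.coeff_succ_X_mul, pow_succ]
        ring
    rw [hsplit, Multiset.map_cons, Multiset.prod_cons, derivative_mul, mul_add]
    have h1 : X * (derivative (1 - C w * X) * (Ω.map fun w => 1 - C w * X).prod) =
      -(C w * X) * (Ω.map fun w => 1 - C w * X).prod := by simp; ring
    have h2 : X * ((1 - C w * X) * derivative (Ω.map fun w => 1 - C w * X).prod) =
      (1 - C w * X) * (X * derivative (Ω.map fun w => 1 - C w * X).prod) := by ring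
    rw [h1, h2, coe_add, coe_mul (1 - C w * X) (X * _), ih, coe_mul, coe_neg, ← hw, coe_mul]
    ring

theorem norm_le_of_log_derivative_recurrence {c S : ℕ → ℂ} {k : ℕ} {q C : ℝ} {s₀ : ℕ} (hq : 0 < q)
    (hk : 0 < k) (hc0 : c 0 = 1) (hck : ∀ d, k ≤ d → c d = 0)
    (hrec : ∀ d : ℕ, (d : ℂ) * c d = ∑ r ∈ Finset.Icc 1 d, S r * c (d - r))
    (hS : ∀ s, s₀ ≤ s → ‖S (2 * s)‖ ≤ C * q ^ s) :
    ‖S 1‖ ≤ ((k : ℝ) - 1) * Real.sqrt q := by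
  set P : ℂ[X] := ∑ d ∈ Finset.range k, monomial d (c d) with hP
  have hPc : ∀ d, P.coeff d = c d := by
    intro d
    simp only [hP, finsetSum_coeff, coeff_monomial, Finset.sum_ite_eq', Finset.mem_range]
    split_ifs with h
    · rfl
    · exact (hck d (by omega)).symm
  obtain ⟨Ω, hcard, hΩ⟩ := exists_eq_prod_one_sub_C_mul_X ((hPc 0).trans hc0)
  have hdeg : P.natDegree ≤ k - 1 := by
    refine natDegree_sum_le_of_forall_le _ _ fun d hd => (natDegree_monomial_le _).trans ?_
    have := Finset.mem_range.1 hd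
    omega
  have h1 : ((X * derivative P : ℂ[X]) : PowerSeries ℂ) = (P : PowerSeries ℂ) *
      PowerSeries.mk fun r => if r = 0 then 0 else S r := by
    ext d
    rw [coeff_coe, mul_comm, mul_comm (P : PowerSeries ℂ), PowerSeries.coeff_mul]
    have h2 : (derivative P * X).coeff d = d * c d := by
      rcases d with _ | d
      · simp
      · rw [coeff_mul_X, coeff_derivative, hPc]; push_cast; ring
    rw [h2, hrec, Finset.Nat.sum_antidiagonal_eq_sum_range_succ_mk]
    simp only [PowerSeries.coeff_mk, coeff_coe, hPc]
    rw [Finset.range_eq_Ico, Finset.sum_eq_sum_Ico_succ_bot (by omega)]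
    simp only [if_true, zero_mul, zero_add]
    refine Finset.sum_congr (by ext; simp) fun r hr => ?_
    rw [if_neg (by have := (Finset.mem_Ico.1 hr).1; omega)]
  have h2 := X_mul_derivative_prod_one_sub_C_mul_X Ω
  rw [← hΩ, h1, neg_mul, ← mul_neg] at h2
  have hP0 : (P : PowerSeries ℂ) ≠ 0 := by
    intro h
    have h3 := congrArg (PowerSeries.coeff 0) h
    rw [coeff_coe, hPc, hc0] at h3
    simp at h3
  have h3 := mul_left_cancel₀ hP0 h2
  have hSr : ∀ r, r ≠ 0 → S r = -(Ω.map fun w => w ^ r).sum := by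
    intro r hr
    have := congrArg (PowerSeries.coeff r) h3
    simpa [hr] using this
  have hw : ∀ w ∈ Ω, ‖w‖ ≤ Real.sqrt q := by
    intro w hw
    have h4 := norm_le_of_norm_sum_pow_le (Ω := Ω.map (· ^ 2)) (ρ := q) (C := C) (s₀ := max s₀ 1) hq
      (fun s hs => by
        have h5 := hS s ((le_max_left _ _).trans hs)
        rw [hSr _ (by have := (le_max_right s₀ 1).trans hs; omega), norm_neg] at h5
        rw [Multiset.map_map]
        simpa [Function.comp_def, pow_mul] using h5) (Multiset.mem_map_of_mem _ hw)
    rw [norm_pow] at h4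
    exact Real.le_sqrt_of_sq_le h4
  rw [hSr 1 one_ne_zero, norm_neg]
  simp only [pow_one, Multiset.map_id']
  have h5 : ‖Ω.sum‖ ≤ (Ω.map fun w => ‖w‖).sum := by
    exact norm_multiset_sum_le Ω
  have h6 : (Ω.map fun w => ‖w‖).sum ≤ Ω.card • Real.sqrt q := by
    have := Multiset.sum_le_card_nsmul (Ω.map fun w => ‖w‖) (Real.sqrt q) (by
      intro x hx
      obtain ⟨w, hwm, rfl⟩ := Multiset.mem_map.1 hx
      exact hw w hwm)
    simpa using this
  refine h5.trans (h6.trans ?_)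
  rw [nsmul_eq_mul]
  refine mul_le_mul_of_nonneg_right ?_ (Real.sqrt_nonneg _)
  have : Ω.card + 1 ≤ k := by omega
  have : (Ω.card : ℝ) + 1 ≤ k := by exact_mod_cast this
  linarith

theorem resultant_right_eq_of_dvd_sub {R : Type*} [CommRing R] {h g₁ g₂ : R[X]} (hh : h.Monic)
    (hdvd : h ∣ g₁ - g₂) : resultant h g₁ = resultant h g₂ := by
  obtain ⟨p, hp⟩ := hdvd
  have h1 : g₁ = g₂ + h * p := by rw [← hp]; ring
  have h2 (g : R[X]) (N : ℕ) (hN : g.natDegree ≤ N) :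
      resultant h g h.natDegree N = resultant h g := by
    obtain ⟨j, rfl⟩ := Nat.exists_eq_add_of_le hN
    rw [resultant_add_right_deg _ _ _ _ _ le_rfl, hh.coeff_natDegree, one_pow, one_mul]
  set N := g₁.natDegree + g₂.natDegree + (p.natDegree + h.natDegree)
  rw [← h2 g₁ N (by omega), ← h2 g₂ N (by omega), h1,
    resultant_add_mul_right _ _ _ _ _ (by omega) le_rfl]

theorem exists_isCoprime_resultant_X_mul_eq {F : Type*} [Field F] {h : F[X]} (hh : h.Monic)
    (h0 : h.eval 0 ≠ 0) {a : F} (ha : a ≠ 0) :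
    ∃ u, resultant (X * h) u = a ∧ IsCoprime (X * h) u := by
  have hcop : IsCoprime X h := by
    rw [← sub_zero (X : F[X]), ← C_0]
    refine (irreducible_X_sub_C (0 : F)).coprime_iff_not_dvd.2 ?_
    rwa [dvd_iff_isRoot]
  obtain ⟨x, y, hxy⟩ := hcop
  set u : F[X] := 1 + C (a - 1) * (y * h) with hu
  have hu0 : u.eval 0 = a := by
    have h1 := congrArg (eval 0) hxy
    simp only [eval_add, eval_mul, eval_X, mul_zero, zero_add, eval_one] at h1
    simp [hu, h1]
  have hres : resultant (X * h) u = a := by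
    have h1 : (X * h).natDegree = (X : F[X]).natDegree + h.natDegree := monic_X.natDegree_mul hh
    rw [h1, resultant_mul_left _ _ _ _ le_rfl, natDegree_X]
    have h2 : resultant X u 1 u.natDegree = a := by
      have := resultant_X_sub_C_left u u.natDegree 0 le_rfl
      rwa [C_0, sub_zero, hu0] at this
    have h3 : resultant h u = 1 := by
      rw [resultant_right_eq_of_dvd_sub (g₂ := 1) hh ⟨C (a - 1) * y, by rw [hu]; ring⟩]
      simp
    rw [h2, h3, mul_one]
  refine ⟨u, hres, ?_⟩
  by_contra hn
  exact ha (hres.symm.trans (resultant_eq_zero_iff.2 ⟨Or.inl (monic_X.mul hh).ne_zero, hn⟩))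

theorem finite_setOf_monic_natDegree_eq (F : Type*) [Field F] [Finite F] (d : ℕ) :
    {g : F[X] | g.Monic ∧ g.natDegree = d}.Finite := by
  have : Finite (degreeLT F (d + 1)) := Module.finite_of_finite F
  refine (Set.toFinite (degreeLT F (d + 1) : Set F[X])).subset ?_
  rintro g ⟨-, rfl⟩
  exact mem_degreeLT.2 (degree_le_natDegree.trans_lt (by exact_mod_cast Nat.lt_succ_self _))

/-- The monic polynomials of degree `d` over a finite field. -/
noncomputable def monicOfDegree (F : Type*) [Field F] [Finite F] (d : ℕ) : Finset F[X] :=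
  (finite_setOf_monic_natDegree_eq F d).toFinset

theorem mem_monicOfDegree {F : Type*} [Field F] [Finite F] {d : ℕ} {g : F[X]} :
    g ∈ monicOfDegree F d ↔ g.Monic ∧ g.natDegree = d := by
  simp [monicOfDegree]

theorem sum_monicOfDegree_mulChar_resultant_eq_zero {F : Type*} [Field F] [Finite F]
    {χ : MulChar F ℂ} (hχ : χ ≠ 1) {h : F[X]} (hh : h.Monic) (h0 : h.eval 0 ≠ 0) {d : ℕ}
    (hd : (X * h).natDegree ≤ d) :
    ∑ g ∈ monicOfDegree F d, χ (resultant g (X * h)) = 0 := by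
  obtain ⟨a, ha⟩ := MulChar.ne_one_iff.1 hχ
  obtain ⟨u, hres, hcop⟩ := exists_isCoprime_resultant_X_mul_eq hh h0 a.ne_zero
  set H := X * h
  have hH : H.Monic := monic_X.mul hh
  have hu : u ≠ 0 := by
    rintro rfl
    refine not_isUnit_X (R := F) (isUnit_of_mul_isUnit_left (y := h) ?_)
    exact isCoprime_zero_right.1 hcop
  have hmod (g : F[X]) : (((u - 1) * g) %ₘ H).degree < H.degree := degree_modByMonic_lt _ hH
  set T : F[X] → F[X] := fun g => g + ((u - 1) * g) %ₘ H with hT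
  have hTdvd (g : F[X]) : H ∣ T g - u * g := by
    have h1 := modByMonic_add_div ((u - 1) * g) H
    refine ⟨-(((u - 1) * g) /ₘ H), ?_⟩
    rw [hT]
    linear_combination h1
  have hTmem : ∀ g ∈ monicOfDegree F d, T g ∈ monicOfDegree F d := by
    intro g hg
    rw [mem_monicOfDegree] at hg ⊢
    have hlt : (((u - 1) * g) %ₘ H).degree < g.degree := by
      refine (hmod g).trans_le ?_
      rw [degree_eq_natDegree hH.ne_zero, degree_eq_natDegree hg.1.ne_zero, hg.2]
      exact_mod_cast hd
    exact ⟨hg.1.add_of_left hlt, by rw [← hg.2]; exact natDegree_add_eq_left_of_degree_lt hlt⟩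
  have hTinj : Set.InjOn T (monicOfDegree F d) := by
    intro g₁ _ g₂ _ h12
    have h1 : H ∣ u * (g₁ - g₂) := by
      have := dvd_sub (hTdvd g₂) (hTdvd g₁)
      rw [h12] at this
      convert this using 1
      ring
    have h2 : H ∣ g₁ - g₂ := hcop.dvd_of_dvd_mul_left h1
    have h3 : ((u - 1) * g₁) %ₘ H = ((u - 1) * g₂) %ₘ H := by
      rw [← sub_eq_zero, ← sub_modByMonic, modByMonic_eq_zero_iff_dvd hH, ← mul_sub]
      exact h2.mul_left _
    simpa [hT, h3] using h12
  have hTχ : ∀ g ∈ monicOfDegree F d, χ (resultant (T g) H) = χ a * χ (resultant g H) := by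
    intro g hg
    have hg' := mem_monicOfDegree.1 hg
    have hTg := mem_monicOfDegree.1 (hTmem g hg)
    rw [← map_mul, resultant_comm (T g), resultant_comm g, hTg.2, hg'.2]
    have h1 : resultant H (T g) = a * resultant H g := by
      rw [resultant_right_eq_of_dvd_sub hH (hTdvd g)]
      rw [natDegree_mul hu hg'.1.ne_zero, resultant_mul_right _ _ _ _ le_rfl, hres]
    rw [hTg.2, hg'.2] at h1
    rw [h1]
    ring_nf
  have hsum : ∑ g ∈ monicOfDegree F d, χ (resultant g H) =
      χ a * ∑ g ∈ monicOfDegree F d, χ (resultant g H) := by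
    rw [Finset.mul_sum, ← Finset.sum_congr rfl hTχ]
    symm
    refine Finset.sum_nbij T hTmem hTinj ?_ fun _ _ => rfl
    exact Finset.surjOn_of_injOn_of_card_le T hTmem hTinj le_rfl
  have h1 : (χ a - 1) * ∑ g ∈ monicOfDegree F d, χ (resultant g H) = 0 := by
    rw [sub_mul, one_mul, ← hsum, sub_self]
  exact (mul_eq_zero.1 h1).resolve_left (sub_ne_zero.2 ha)

/-- The monic irreducible polynomials of degree at most `d` over a finite field. -/
noncomputable def monicIrreducible (F : Type*) [Field F] [Finite F] (d : ℕ) : Finset F[X] :=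
  open Classical in ((Finset.range (d + 1)).biUnion (monicOfDegree F)).filter Irreducible

theorem mem_monicIrreducible {F : Type*} [Field F] [Finite F] {d : ℕ} {P : F[X]} :
    P ∈ monicIrreducible F d ↔ P.Monic ∧ Irreducible P ∧ P.natDegree ≤ d := by
  simp only [monicIrreducible, Finset.mem_filter, Finset.mem_biUnion, Finset.mem_range,
    mem_monicOfDegree]
  constructor
  · rintro ⟨⟨i, hi, h1, h2⟩, h3⟩
    exact ⟨h1, h3, by omega⟩
  · rintro ⟨h1, h2, h3⟩
    exact ⟨⟨_, Nat.lt_succ_of_le h3, h1, rfl⟩, h2⟩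

open Classical in
theorem natDegree_eq_sum_monicIrreducible {F : Type*} [Field F] [Finite F] {g : F[X]}
    (hg : g.Monic) :
    g.natDegree = ∑ P ∈ monicIrreducible F g.natDegree, ∑ j ∈ Finset.Icc 1 g.natDegree,
      if P ^ j ∣ g then P.natDegree else 0 := by
  set N := UniqueFactorizationMonoid.normalizedFactors g with hN
  have hprod : N.prod = g := by
    have h1 := UniqueFactorizationMonoid.prod_normalizedFactors_eq hg.ne_zero
    rw [← hN, hg.normalize_eq_self] at h1
    exact h1
  have hmem : ∀ P ∈ N, P.Monic ∧ Irreducible P ∧ P ∣ g := by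
    intro P hP
    have h1 := UniqueFactorizationMonoid.irreducible_of_normalized_factor P hP
    refine ⟨?_, h1, UniqueFactorizationMonoid.dvd_of_mem_normalizedFactors hP⟩
    rw [← UniqueFactorizationMonoid.normalize_normalized_factor P hP]
    exact monic_normalize h1.ne_zero
  have hdeg : g.natDegree = (N.map natDegree).sum := by
    conv_lhs => rw [← hprod]
    exact natDegree_multiset_prod_of_monic _ fun P hP => (hmem P hP).1
  have hcount : ∀ P, P.Monic → Irreducible P → ∀ j, P ^ j ∣ g ↔ j ≤ N.count P := by
    intro P hPm hP j
    rw [pow_dvd_iff_le_emultiplicity,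
      UniqueFactorizationMonoid.emultiplicity_eq_count_normalizedFactors hP hg.ne_zero,
      hPm.normalize_eq_self, Nat.cast_le]
  conv_lhs => rw [hdeg, Finset.sum_multiset_map_count]
  have hsub : N.toFinset ⊆ monicIrreducible F g.natDegree := by
    intro P hP
    obtain ⟨h1, h2, h3⟩ := hmem P (Multiset.mem_toFinset.1 hP)
    exact mem_monicIrreducible.2 ⟨h1, h2, natDegree_le_of_dvd h3 hg.ne_zero⟩
  rw [Finset.sum_subset hsub fun P _ hP => by
    rw [Multiset.count_eq_zero_of_notMem (fun h => hP (Multiset.mem_toFinset.2 h)), zero_smul]]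
  refine Finset.sum_congr rfl fun P hP => ?_
  obtain ⟨h1, h2, -⟩ := mem_monicIrreducible.1 hP
  simp only [hcount P h1 h2]
  rw [← Finset.sum_filter, Finset.sum_const]
  have hle : N.count P ≤ g.natDegree := by
    have h3 := natDegree_le_of_dvd ((hcount P h1 h2 _).2 le_rfl) hg.ne_zero
    rw [natDegree_pow] at h3
    exact (Nat.le_mul_of_pos_right _ h2.natDegree_pos).trans h3
  congr 1
  have : {j ∈ Finset.Icc 1 g.natDegree | j ≤ N.count P} = Finset.Icc 1 (N.count P) := by
    ext j
    simp only [Finset.mem_filter, Finset.mem_Icc]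
    omega
  rw [this, Nat.card_Icc, Nat.add_sub_cancel]

open Classical in
theorem sum_monicOfDegree_ite_pow_dvd {F : Type*} [Field F] [Finite F] {ψ : F[X] → ℂ}
    (hψ1 : ψ 1 = 1) (hψ : ∀ f g : F[X], f.Monic → g.Monic → ψ (f * g) = ψ f * ψ g) {P : F[X]}
    (hP : P.Monic) (d j : ℕ) :
    (∑ g ∈ monicOfDegree F d, if P ^ j ∣ g then ψ g else 0) =
      if j * P.natDegree ≤ d then ψ P ^ j * ∑ g ∈ monicOfDegree F (d - j * P.natDegree), ψ g
      else 0 := by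
  have hpow : ψ (P ^ j) = ψ P ^ j := by
    induction j with
    | zero => simpa using hψ1
    | succ j ih => rw [pow_succ, hψ _ _ (hP.pow j) hP, ih, pow_succ]
  have hPj := hP.pow j
  have hdeg := hP.natDegree_pow j
  split_ifs with hle
  · rw [← Finset.sum_filter, Finset.mul_sum]
    symm
    refine Finset.sum_bij (fun g _ => P ^ j * g) ?_ ?_ ?_ ?_
    · intro g hg
      obtain ⟨h1, h2⟩ := mem_monicOfDegree.1 hg
      refine Finset.mem_filter.2 ⟨mem_monicOfDegree.2 ⟨hPj.mul h1, ?_⟩, dvd_mul_right _ _⟩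
      rw [hPj.natDegree_mul h1, hdeg, h2]
      omega
    · intro a _ b _ hab
      exact mul_left_cancel₀ hPj.ne_zero hab
    · intro g hg
      obtain ⟨h1, r, hr⟩ := Finset.mem_filter.1 hg
      obtain ⟨h1, h2⟩ := mem_monicOfDegree.1 h1
      have hrm : r.Monic := hPj.of_mul_monic_left (hr ▸ h1)
      refine ⟨r, mem_monicOfDegree.2 ⟨hrm, ?_⟩, hr.symm⟩
      rw [hr, hPj.natDegree_mul hrm, hdeg] at h2
      omega
    · intro g hg
      rw [hψ _ _ hPj (mem_monicOfDegree.1 hg).1, hpow]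
  · refine Finset.sum_eq_zero fun g hg => if_neg fun hdvd => hle ?_
    obtain ⟨h1, h2⟩ := mem_monicOfDegree.1 hg
    rw [← hdeg, ← h2]
    exact natDegree_le_of_dvd hdvd h1.ne_zero

theorem natCast_mul_sum_monicOfDegree {F : Type*} [Field F] [Finite F] {ψ : F[X] → ℂ}
    (hψ1 : ψ 1 = 1) (hψ : ∀ f g : F[X], f.Monic → g.Monic → ψ (f * g) = ψ f * ψ g) (d : ℕ) :
    (d : ℂ) * ∑ g ∈ monicOfDegree F d, ψ g =
      ∑ r ∈ Finset.Icc 1 d, (∑ P ∈ monicIrreducible F r with P.natDegree ∣ r,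
        (P.natDegree : ℂ) * ψ P ^ (r / P.natDegree)) * ∑ g ∈ monicOfDegree F (d - r), ψ g := by
  classical
  have h1 : (d : ℂ) * ∑ g ∈ monicOfDegree F d, ψ g = ∑ P ∈ monicIrreducible F d,
      ∑ j ∈ Finset.Icc 1 d, (P.natDegree : ℂ) *
        ∑ g ∈ monicOfDegree F d, if P ^ j ∣ g then ψ g else 0 := by
    simp only [Finset.mul_sum]
    simp_rw [Finset.sum_comm (t := monicOfDegree F d)]
    refine Finset.sum_congr rfl fun g hg => ?_
    obtain ⟨hgm, hgd⟩ := mem_monicOfDegree.1 hg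
    have h2 := natDegree_eq_sum_monicIrreducible hgm
    rw [hgd] at h2
    conv_lhs => rw [h2]
    push_cast
    rw [Finset.sum_mul]
    refine Finset.sum_congr rfl fun P _ => ?_
    rw [Finset.sum_mul]
    refine Finset.sum_congr rfl fun j _ => ?_
    split_ifs <;> simp
  have h2 : ∀ r ∈ Finset.Icc 1 d, (∑ P ∈ monicIrreducible F r with P.natDegree ∣ r,
        (P.natDegree : ℂ) * ψ P ^ (r / P.natDegree)) * ∑ g ∈ monicOfDegree F (d - r), ψ g =
      ∑ P ∈ monicIrreducible F d, if P.natDegree ∣ r then (P.natDegree : ℂ) *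
        (ψ P ^ (r / P.natDegree) * ∑ g ∈ monicOfDegree F (d - r), ψ g) else 0 := by
    intro r hr
    have hr' := Finset.mem_Icc.1 hr
    rw [← Finset.sum_filter, Finset.sum_mul]
    have : {P ∈ monicIrreducible F r | P.natDegree ∣ r} =
        {P ∈ monicIrreducible F d | P.natDegree ∣ r} := by
      ext P
      simp only [Finset.mem_filter, mem_monicIrreducible]
      constructor
      · rintro ⟨⟨a, b, c⟩, e⟩
        exact ⟨⟨a, b, c.trans hr'.2⟩, e⟩
      · rintro ⟨⟨a, b, c⟩, e⟩
        exact ⟨⟨a, b, Nat.le_of_dvd (by omega) e⟩, e⟩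
    rw [this]
    exact Finset.sum_congr rfl fun P _ => by ring
  rw [h1, Finset.sum_congr rfl h2, Finset.sum_comm (s := Finset.Icc 1 d)]
  refine Finset.sum_congr rfl fun P hP => ?_
  obtain ⟨hPm, hPi, -⟩ := mem_monicIrreducible.1 hP
  have hpos : 0 < P.natDegree := hPi.natDegree_pos
  simp only [sum_monicOfDegree_ite_pow_dvd hψ1 hψ hPm, mul_ite, mul_zero]
  rw [← Finset.sum_filter, ← Finset.sum_filter]
  refine Finset.sum_nbij' (· * P.natDegree) (· / P.natDegree) ?_ ?_ ?_ ?_ ?_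
  · intro j hj
    simp only [Finset.mem_filter, Finset.mem_Icc] at hj ⊢
    exact ⟨⟨Nat.mul_pos hj.1.1 hpos, hj.2⟩, dvd_mul_left _ _⟩
  · intro r hr
    simp only [Finset.mem_filter, Finset.mem_Icc] at hr ⊢
    obtain ⟨⟨h3, h4⟩, i, rfl⟩ := hr
    rw [Nat.mul_div_cancel_left _ hpos, mul_comm i]
    refine ⟨⟨Nat.pos_of_mul_pos_left h3, ?_⟩, h4⟩
    exact (Nat.le_mul_of_pos_left _ hpos).trans h4
  · intro j _
    exact Nat.mul_div_cancel _ hpos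
  · intro r hr
    exact Nat.div_mul_cancel (Finset.mem_filter.1 hr).2
  · intro j _
    simp only [Nat.mul_div_cancel _ hpos]

theorem PowerBasis.norm_aeval_gen_eq_resultant {K M : Type*} [Field K] [Field M] [Algebra K M]
    [FiniteDimensional K M] [Algebra.IsSeparable K M] (pb : PowerBasis K M) (h : K[X]) :
    Algebra.norm K (aeval pb.gen h) = resultant (minpoly K pb.gen) h := by
  classical
  let E := AlgebraicClosure K
  have hmon : (minpoly K pb.gen).Monic := minpoly.monic pb.isIntegral_gen
  apply (algebraMap K E).injective
  rw [Algebra.norm_eq_prod_embeddings K E, ← resultant_map_map,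
    ← natDegree_map (algebraMap K E) (p := minpoly K pb.gen),
    resultant_eq_prod_eval _ _ _ natDegree_map_le (IsAlgClosed.splits _),
    (hmon.map _).leadingCoeff, one_pow, one_mul]
  rw [@Fintype.prod_equiv (M →ₐ[K] E) _ _ _ _ _ pb.liftEquiv'
    (fun σ => σ (aeval pb.gen h)) (fun x => (h.map (algebraMap K E)).eval (x : E)) ?_]
  · rw [Finset.prod_mem_multiset _ _ (fun x => (h.map (algebraMap K E)).eval x) fun _ => rfl,
      Finset.prod_eq_multiset_prod, Multiset.toFinset_val, Multiset.dedup_eq_self.mpr]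
    exact nodup_roots (.map (Algebra.IsSeparable.isSeparable K pb.gen))
  · intro σ
    rw [PowerBasis.liftEquiv'_apply_coe, eval_map_algebraMap, aeval_algHom_apply]

theorem norm_aeval_eq_resultant_pow {K L : Type*} [Field K] [Field L] [Algebra K L]
    [FiniteDimensional K L] [Algebra.IsSeparable K L] (x : L) (h : K[X]) :
    Algebra.norm K (aeval x h) =
      resultant (minpoly K x) h ^ (Module.finrank K L / (minpoly K x).natDegree) := by
  have hx := Algebra.IsSeparable.isIntegral K x
  let M := IntermediateField.adjoin K {x}
  let pb := IntermediateField.adjoin.powerBasis hx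
  have hgen : algebraMap M L pb.gen = x := by
    rw [IntermediateField.adjoin.powerBasis_gen]
    exact IntermediateField.AdjoinSimple.algebraMap_gen K x
  have hmin : minpoly K pb.gen = minpoly K x := by
    rw [← minpoly.algebraMap_eq (algebraMap M L).injective, hgen]
  have : Algebra.IsSeparable K M := Algebra.isSeparable_tower_bot_of_isSeparable K M L
  have h1 : aeval x h = algebraMap M L (aeval pb.gen h) := by
    rw [← aeval_algebraMap_apply, hgen]
  have h2 : Module.finrank K L / (minpoly K x).natDegree = Module.finrank M L := by
    rw [← Module.finrank_mul_finrank K M L, IntermediateField.adjoin.finrank hx,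
      Nat.mul_div_cancel_left _ (minpoly.natDegree_pos hx)]
  rw [h1, ← Algebra.norm_norm (S := M), Algebra.norm_algebraMap, map_pow,
    PowerBasis.norm_aeval_gen_eq_resultant, hmin, h2]

theorem card_filter_minpoly_eq {F K : Type*} [Field F] [Finite F] [Field K] [Fintype K]
    [DecidableEq F[X]] [Algebra F K] {P : F[X]} (hPm : P.Monic) (hP : Irreducible P)
    (hdvd : P.natDegree ∣ Module.finrank F K) :
    (Finset.univ.filter fun t : K => minpoly F t = P).card = P.natDegree := by
  classical
  have hiff (t : K) : minpoly F t = P ↔ t ∈ (P.aroots K).toFinset := by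
    rw [Multiset.mem_toFinset, mem_aroots]
    constructor
    · rintro rfl
      exact ⟨hPm.ne_zero, minpoly.aeval F t⟩
    · rintro ⟨-, ht⟩
      exact (minpoly.eq_of_irreducible_of_monic hP ht hPm).symm
  have hcard : Nat.card F ^ Module.finrank F K = Fintype.card K := by
    rw [← Module.natCard_eq_pow_finrank, Nat.card_eq_fintype_card]
  have h1 := hP.natDegree_dvd_iff_dvd_X_pow_card_pow_sub_X.1 hdvd
  rw [hcard] at h1
  have h2 := Polynomial.map_dvd (algebraMap F K) h1
  rw [Polynomial.map_sub, Polynomial.map_pow, map_X] at h2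
  have h3 : (X ^ Fintype.card K - X : K[X]).Splits := by
    rw [splits_iff_card_roots, FiniteField.roots_X_pow_card_sub_X,
      FiniteField.X_pow_card_sub_X_natDegree_eq K Fintype.one_lt_card]
    rfl
  have h0 : (X ^ Fintype.card K - X : K[X]) ≠ 0 :=
    FiniteField.X_pow_card_sub_X_ne_zero K Fintype.one_lt_card
  have h4 := h3.of_dvd h0 h2
  have h5 : (P.aroots K).Nodup := by
    refine Multiset.nodup_of_le (roots.le_of_dvd h0 h2) ?_
    rw [FiniteField.roots_X_pow_card_sub_X]
    exact Finset.nodup _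
  simp only [hiff, Finset.filter_mem_eq_inter, Finset.univ_inter]
  rw [Multiset.toFinset_card_of_nodup h5, aroots_def, ← h4.natDegree_eq_card_roots, natDegree_map]

theorem sum_mulChar_norm_aeval {F K : Type*} [Field F] [Finite F] [Field K] [Fintype K]
    [Algebra F K] (χ : MulChar F ℂ) (h : F[X]) :
    ∑ t : K, χ (Algebra.norm F (aeval t h)) =
      ∑ P ∈ monicIrreducible F (Module.finrank F K) with P.natDegree ∣ Module.finrank F K,
        (P.natDegree : ℂ) * χ (resultant P h) ^ (Module.finrank F K / P.natDegree) := by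
  classical
  set r := Module.finrank F K
  have hmaps : ∀ t ∈ (Finset.univ : Finset K), minpoly F t ∈
      (monicIrreducible F r).filter fun P => P.natDegree ∣ r := by
    intro t _
    have ht := Algebra.IsSeparable.isIntegral F t
    refine Finset.mem_filter.2 ⟨mem_monicIrreducible.2 ⟨minpoly.monic ht, minpoly.irreducible ht,
      minpoly.natDegree_le t⟩, minpoly.degree_dvd ht⟩
  rw [← Finset.sum_fiberwise_of_maps_to hmaps]
  refine Finset.sum_congr rfl fun P hP => ?_
  obtain ⟨hP, hdvd⟩ := Finset.mem_filter.1 hP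
  obtain ⟨hPm, hPi, -⟩ := mem_monicIrreducible.1 hP
  rw [Finset.sum_congr rfl (g := fun _ => χ (resultant P h) ^ (r / P.natDegree)), Finset.sum_const,
    card_filter_minpoly_eq hPm hPi hdvd, nsmul_eq_mul]
  intro t ht
  rw [norm_aeval_eq_resultant_pow, (Finset.mem_filter.1 ht).2, map_pow]

theorem exists_mulChar_eq_norm (F : Type*) {K : Type*} [Field F] [Finite F] [Field K] [Finite K]
    [Algebra F K] (χ : MulChar F ℂ) : ∃ ψ : MulChar K ℂ, ∀ y, ψ y = χ (Algebra.norm F y) :=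
  ⟨{ toMonoidHom := χ.toMonoidHom.comp (Algebra.norm F)
     map_nonunit' := by
      intro y hy
      have hy0 : y = 0 := by_contra fun h => hy (isUnit_iff_ne_zero.2 h)
      subst hy0
      change χ (Algebra.norm F (0 : K)) = 0
      rw [Algebra.norm_zero, MulChar.map_zero] }, fun _ => rfl⟩

/-- The Weil bound for multiplicative character sums. -/
theorem norm_sum_mulChar_eval_X_mul_le {F : Type*} [Field F] [Fintype F] {h : F[X]} (hh : h.Monic)
    (h0 : h.eval 0 ≠ 0) {m k : ℕ} (hk : (X * h).natDegree = k) (hm : 0 < m)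
    (hmq : m ∣ Fintype.card F - 1) (hmk : m.Coprime k) {χ : MulChar F ℂ} (hχm : χ ^ m = 1)
    (hχ : χ ≠ 1) :
    ‖∑ x, χ ((X * h).eval x)‖ ≤ ((k : ℝ) - 1) * Real.sqrt (Fintype.card F) := by
  have hdeg : (X * h).natDegree = h.natDegree + 1 := natDegree_X_mul hh.ne_zero
  set H := X * h with hH
  have hHm : H.Monic := monic_X.mul hh
  obtain ⟨p, hp⟩ := CharP.exists F
  obtain ⟨n₀, hpp, hcard⟩ := FiniteField.card F p
  have : Fact p.Prime := ⟨hpp⟩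
  have hq : 1 < Fintype.card F := Fintype.one_lt_card
  have hψ1 : χ (resultant 1 H) = 1 := by simp
  have hψ (f g : F[X]) (hf : f.Monic) (hg : g.Monic) :
      χ (resultant (f * g) H) = χ (resultant f H) * χ (resultant g H) := by
    rw [hf.natDegree_mul hg, resultant_mul_left _ _ _ _ le_rfl, map_mul]
  have hone : monicOfDegree F 0 = {1} := by
    ext g
    rw [mem_monicOfDegree, Finset.mem_singleton]
    exact ⟨fun hg => hg.1.natDegree_eq_zero.1 hg.2, by rintro rfl; simp⟩
  have key := norm_le_of_log_derivative_recurrence (q := Fintype.card F) (k := k)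
    (c := fun d => ∑ g ∈ monicOfDegree F d, χ (resultant g H))
    (S := fun r => ∑ P ∈ monicIrreducible F r with P.natDegree ∣ r,
        (P.natDegree : ℂ) * χ (resultant P H) ^ (r / P.natDegree))
    (C := (m * (2 * (2 + m * k) + k) + k : ℕ)) (s₀ := m * (2 * (m * k) + 5) + 1)
    (by positivity) (by omega) (by rw [hone, Finset.sum_singleton, hψ1])
    (fun d hd => sum_monicOfDegree_mulChar_resultant_eq_zero hχ hh h0 (hk.trans_le hd))
    (natCast_mul_sum_monicOfDegree hψ1 hψ) ?_
  · have h1 := sum_mulChar_norm_aeval (K := F) χ H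
    rw [Module.finrank_self] at h1
    rw [← h1] at key
    simpa using key
  · intro s hs
    have : NeZero (2 * s) := ⟨by omega⟩
    let K := FiniteField.Extension F p (2 * s)
    let := Fintype.ofFinite K
    have h1 := sum_mulChar_norm_aeval (K := K) χ H
    rw [FiniteField.finrank_extension] at h1
    obtain ⟨ψ, hψχ⟩ := exists_mulChar_eq_norm F (K := K) χ
    have : CharP K p := charP_of_injective_algebraMap (algebraMap F K).injective p
    have hcardK : Fintype.card K = (p ^ (n₀ * s)) ^ 2 := by
      rw [← Nat.card_eq_fintype_card, FiniteField.natCard_extension, Nat.card_eq_fintype_card,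
        hcard]
      ring
    have hqs : p ^ (n₀ * s : ℕ) = Fintype.card F ^ s := by rw [hcard, pow_mul]
    have hdvd : m ∣ Fintype.card F ^ s - 1 :=
      hmq.trans (by simpa using Nat.sub_dvd_pow_sub_pow (Fintype.card F) 1 s)
    obtain ⟨e, he⟩ := hdvd
    have hpos : 0 < Fintype.card F ^ s := by positivity
    have hlarge : 2 * (m * k) + 5 ≤ e := by
      have h2 : s < Fintype.card F ^ s := Nat.lt_pow_self hq
      refine le_of_mul_le_mul_left ?_ hm
      omega
    have hψm : ψ ^ m = 1 := by
      ext y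
      rw [MulChar.pow_apply_coe, hψχ, MulChar.one_apply_coe, ← MulChar.pow_apply' _ hm.ne', hχm,
        MulChar.one_apply]
      exact (y.isUnit).map (Algebra.norm F)
    have hψne : ψ ≠ 1 := by
      obtain ⟨a, ha⟩ := MulChar.ne_one_iff.1 hχ
      obtain ⟨y, hy⟩ := FiniteField.unitsMap_norm_surjective F K a
      refine MulChar.ne_one_iff.2 ⟨y, ?_⟩
      rw [hψχ]
      rwa [← hy] at ha
    have h3 := norm_sum_mulChar_eval_le hcardK (h := H.map (algebraMap F K)) (hHm.map _).ne_zero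
      (by rw [natDegree_map, hk]) hm hmk (by rw [hqs]; omega) hlarge hψm hψne
    rw [hqs] at h3
    rw [← h1]
    simp only [hψχ, eval_map_algebraMap] at h3
    exact_mod_cast h3

theorem exists_pow_eq_iff_mulChar_eq_one {F : Type*} [Field F] [Fintype F] {d m : ℕ}
    (hm : d.gcd (Fintype.card F - 1) = m) {χ : MulChar F ℂ} (hχ : orderOf χ = m) (u : Fˣ) :
    (∃ x : Fˣ, x ^ d = u) ↔ χ u = 1 := by
  have hχm : χ ^ m = 1 := hχ ▸ pow_orderOf_eq_one χ
  constructor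
  · rintro ⟨x, rfl⟩
    obtain ⟨e, rfl⟩ : m ∣ d := hm ▸ Nat.gcd_dvd_left _ _
    rw [Units.val_pow_eq_pow_val, map_pow, pow_mul, ← MulChar.pow_apply_coe, hχm,
      MulChar.one_apply_coe, one_pow]
  · intro hu
    obtain ⟨g, hg⟩ := IsCyclic.exists_generator (α := Fˣ)
    obtain ⟨j, rfl⟩ := mem_powers_iff_mem_zpowers.2 (hg u)
    have hj : m ∣ j := by
      rw [← hχ, orderOf_dvd_iff_pow_eq_one, MulChar.eq_iff hg, MulChar.pow_apply_coe,
        MulChar.one_apply_coe]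
      simpa using hu
    obtain ⟨i, rfl⟩ := hj
    have h1 : g ^ (Fintype.card F - 1) = 1 := by
      classical
      rw [← Fintype.card_units, pow_card_eq_one]
    have h2 : g ^ m = (g ^ (d.gcdA (Fintype.card F - 1))) ^ d := by
      have h3 := Nat.gcd_eq_gcd_ab d (Fintype.card F - 1)
      rw [hm] at h3
      rw [← zpow_natCast g m, h3, zpow_add, zpow_mul, zpow_mul, zpow_natCast, zpow_natCast, h1,
        one_zpow, mul_one, ← zpow_natCast, ← zpow_mul, ← zpow_natCast, ← zpow_mul, mul_comm]
    exact ⟨(g ^ (d.gcdA (Fintype.card F - 1))) ^ i, by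
      rw [← pow_mul, mul_comm, pow_mul, ← h2, ← pow_mul]⟩

theorem card_filter_units_pow_mul_eq {F : Type*} [Field F] [Fintype F] [DecidableEq F] {d m : ℕ}
    (hm : d.gcd (Fintype.card F - 1) = m) {χ : MulChar F ℂ} (hχ : orderOf χ = m) {b : F}
    (hb : b ≠ 0) (y : F) :
    ((Finset.univ.filter fun x : Fˣ => (x : F) ^ d * y = b).card : ℂ) =
      ∑ i ∈ Finset.range m, (χ ^ i) (b⁻¹ * y) := by
  obtain rfl | hy := eq_or_ne y 0
  · simp [hb.symm, MulChar.map_zero]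
  set u : Fˣ := Units.mk0 (b * y⁻¹) (mul_ne_zero hb (inv_ne_zero hy)) with hu
  have hχm : χ ^ m = 1 := hχ ▸ pow_orderOf_eq_one χ
  have hiff (x : Fˣ) : (x : F) ^ d * y = b ↔ x ^ d = u := by
    rw [Units.ext_iff, Units.val_pow_eq_pow_val, hu, Units.val_mk0, ← div_eq_mul_inv,
      eq_div_iff hy]
  have hby : b⁻¹ * y = ((u⁻¹ : Fˣ) : F) := by
    rw [hu, Units.val_inv_eq_inv_val, Units.val_mk0, mul_inv, inv_inv]
  simp only [hiff, hby, MulChar.pow_apply_coe]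
  have hinv : χ ((u⁻¹ : Fˣ) : F) * χ u = 1 := by
    rw [← map_mul, Units.inv_mul, map_one]
  by_cases hex : ∃ x : Fˣ, x ^ d = u
  · have h1 := (exists_pow_eq_iff_mulChar_eq_one hm hχ u).1 hex
    rw [h1, mul_one] at hinv
    simp only [hinv, one_pow, Finset.sum_const, Finset.card_range, nsmul_eq_mul, mul_one]
    have h2 := MonoidHom.card_fiber_eq_of_mem_range (powMonoidHom d : Fˣ →* Fˣ) (x := u)
      (y := 1) hex
      ⟨1, by simp⟩
    simp only [powMonoidHom_apply] at h2
    rw [h2]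
    have h3 := IsCyclic.card_powMonoidHom_ker (G := Fˣ) d
    rw [Nat.card_eq_fintype_card (α := Fˣ), Fintype.card_units, Nat.gcd_comm, hm,
      Nat.card_eq_fintype_card, Fintype.card_subtype] at h3
    simp only [MonoidHom.mem_ker, powMonoidHom_apply] at h3
    rw [h3]
  · have h1 : χ ((u⁻¹ : Fˣ) : F) ≠ 1 := by
      intro h
      rw [h, one_mul] at hinv
      exact hex ((exists_pow_eq_iff_mulChar_eq_one hm hχ u).2 hinv)
    have h2 : (χ ((u⁻¹ : Fˣ) : F)) ^ m = 1 := by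
      rw [← MulChar.pow_apply_coe, hχm, MulChar.one_apply_coe]
    rw [Finset.filter_eq_empty_iff.2 fun x _ hx => hex ⟨x, hx⟩, geom_sum_eq h1, h2]
    simp

theorem le_card_filter_pow_mul_eval_eq {F : Type*} [Field F] [Fintype F] [DecidableEq F]
    {h : F[X]} (hh : h.Monic) (h0 : h.eval 0 ≠ 0) {k m : ℕ} (hk : (X * h).natDegree = k)
    (hm : (k + 1).gcd (Fintype.card F - 1) = m) {b : F} (hb : b ≠ 0) :
    (Fintype.card F : ℝ) - k - (m - 1) * ((k - 1) * Real.sqrt (Fintype.card F)) ≤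
      (Finset.univ.filter fun z : Fˣ × F =>
        (z.1 : F) ^ (k + 1) * (X * h).eval z.2 = b).card := by
  set q := Fintype.card F
  set H := X * h with hH
  have hHm : H.Monic := monic_X.mul hh
  have hmq : m ∣ q - 1 := hm ▸ Nat.gcd_dvd_right _ _
  have hmk : m ∣ k + 1 := hm ▸ Nat.gcd_dvd_left _ _
  have hmpos : 0 < m := Nat.pos_of_dvd_of_pos hmk (Nat.succ_pos k)
  have hcop : m.Coprime k := Nat.Coprime.coprime_dvd_left hmk (by simp)
  obtain ⟨χ, hχ⟩ := MulChar.exists_mulChar_orderOf F hmq (Complex.isPrimitiveRoot_exp m hmpos.ne')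
  have hχm : χ ^ m = 1 := hχ ▸ pow_orderOf_eq_one χ
  set S : ℕ → ℂ := fun i => ∑ t, (χ ^ i) (H.eval t)
  have hN : ((Finset.univ.filter fun z : Fˣ × F =>
      (z.1 : F) ^ (k + 1) * H.eval z.2 = b).card : ℂ) =
      ∑ i ∈ Finset.range m, (χ ^ i) b⁻¹ * S i := by
    have h1 : (Finset.univ.filter fun z : Fˣ × F =>
        (z.1 : F) ^ (k + 1) * H.eval z.2 = b).card =
        ∑ t : F, (Finset.univ.filter fun x : Fˣ => (x : F) ^ (k + 1) * H.eval t = b).card := by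
      simp only [Finset.card_filter, ← Finset.univ_product_univ, Finset.sum_product_right]
    rw [h1]
    push_cast
    simp only [card_filter_units_pow_mul_eq hm hχ hb, map_mul]
    rw [Finset.sum_comm]
    exact Finset.sum_congr rfl fun i _ => (Finset.mul_sum _ _ _).symm
  have hS0 : S 0 = ((Finset.univ.filter fun t : F => H.eval t ≠ 0).card : ℂ) := by
    rw [Finset.card_filter]
    push_cast
    refine Finset.sum_congr rfl fun t _ => ?_
    rw [pow_zero]
    split_ifs with ht
    · exact MulChar.one_apply (isUnit_iff_ne_zero.2 ht)
    · rw [not_not.1 ht, MulChar.map_zero]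
  have hS0' : (q : ℝ) - k ≤ (Finset.univ.filter fun t : F => H.eval t ≠ 0).card := by
    have h1 : (Finset.univ.filter fun t : F => H.eval t = 0).card ≤ k := by
      rw [← hk]
      refine (Finset.card_le_card (t := H.roots.toFinset) ?_).trans
        ((Multiset.toFinset_card_le _).trans (card_roots' _))
      intro t ht
      simpa [hHm.ne_zero] using ht
    have h2 := Finset.card_filter_add_card_filter_not (s := (Finset.univ : Finset F))
      (fun t : F => H.eval t = 0)
    rw [Finset.card_univ] at h2
    simp only [← ne_eq] at h2
    have h3 : q ≤ (Finset.univ.filter fun t : F => H.eval t ≠ 0).card + k := by omega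
    have : (q : ℝ) ≤ (Finset.univ.filter fun t : F => H.eval t ≠ 0).card + k := by
      exact_mod_cast h3
    linarith
  have hb1 (i : ℕ) : ‖(χ ^ i) b⁻¹‖ ≤ 1 := by
    refine (Complex.norm_eq_one_of_pow_eq_one (n := m) ?_ hmpos.ne').le
    rw [← Units.val_mk0 (inv_ne_zero hb), ← MulChar.pow_apply_coe, ← pow_mul, mul_comm, pow_mul,
      hχm, one_pow, MulChar.one_apply_coe]
  have hSi : ∀ i ∈ Finset.Ico 1 m, ‖(χ ^ i) b⁻¹ * S i‖ ≤ (k - 1) * Real.sqrt q := by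
    intro i hi
    obtain ⟨hi1, hi2⟩ := Finset.mem_Ico.1 hi
    rw [norm_mul]
    refine (mul_le_of_le_one_left (norm_nonneg _) (hb1 i)).trans ?_
    refine norm_sum_mulChar_eval_X_mul_le hh h0 hk hmpos hmq hcop ?_ ?_
    · rw [← pow_mul, mul_comm, pow_mul, hχm, one_pow]
    · exact pow_ne_one_of_lt_orderOf (by omega) (by omega)
  rw [Finset.range_eq_Ico, Finset.sum_eq_sum_Ico_succ_bot hmpos, pow_zero,
    MulChar.one_apply (isUnit_iff_ne_zero.2 (inv_ne_zero hb)), one_mul, hS0] at hN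
  have h5 := norm_sum_le_of_le _ hSi
  rw [Finset.sum_const, Nat.card_Ico, nsmul_eq_mul, Nat.cast_sub hmpos, Nat.cast_one] at h5
  have h6 := Complex.re_le_norm (-∑ i ∈ Finset.Ico 1 m, (χ ^ i) b⁻¹ * S i)
  rw [norm_neg, Complex.neg_re] at h6
  have h7 := congrArg Complex.re hN
  rw [Complex.add_re, Complex.natCast_re, Complex.natCast_re, zero_add] at h7
  linarith

theorem card_offDiag_filter_eq_le {α β : Type*} [DecidableEq α] [DecidableEq β] {G : α → β}
    {T S : Finset α} {d : ℕ} (hG : Set.InjOn G (T \ S : Finset α))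
    (hd : ∀ v, (T.filter fun x => G x = v).card ≤ d) :
    (T.offDiag.filter fun z => G z.1 = G z.2).card ≤ d * S.card := by
  have hmaps : Set.MapsTo (fun z : α × α => G z.1)
      (T.offDiag.filter fun z => G z.1 = G z.2) (T.image G) := by
    intro z hz
    simp only [Finset.coe_filter, Finset.mem_offDiag, Set.mem_ofPred_eq] at hz
    exact Finset.mem_coe.2 (Finset.mem_image_of_mem G hz.1.1)
  rw [Finset.card_eq_sum_card_fiberwise hmaps]
  calc _ ≤ ∑ v ∈ T.image G, d * (S.filter fun x => G x = v).card := by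
        refine Finset.sum_le_sum fun v _ => ?_
        have h1 : ((T \ S).filter fun x => G x = v).card ≤ 1 := by
          refine Finset.card_le_one.2 fun x hx y hy => ?_
          rw [Finset.mem_filter] at hx hy
          exact hG hx.1 hy.1 (hx.2.trans hy.2.symm)
        have h2 : (T.filter fun x => G x = v) ⊆
            ((T \ S).filter fun x => G x = v) ∪ (S.filter fun x => G x = v) := by
          intro x hx
          simp only [Finset.mem_filter, Finset.mem_union, Finset.mem_sdiff] at hx ⊢
          tauto
        have h3 := (Finset.card_le_card h2).trans (Finset.card_union_le _ _)
        have h4 : (T.filter fun x => G x = v).card - 1 ≤ (S.filter fun x => G x = v).card := by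
          omega
        refine (Finset.card_le_card (t := (T.filter fun x => G x = v).offDiag) ?_).trans ?_
        · rintro ⟨x, y⟩ hz
          simp only [Finset.mem_filter, Finset.mem_offDiag] at hz ⊢
          exact ⟨⟨hz.1.1.1, hz.2⟩, ⟨hz.1.1.2.1, hz.1.2 ▸ hz.2⟩, hz.1.1.2.2⟩
        · rw [Finset.offDiag_card, ← Nat.mul_sub_one]
          exact Nat.mul_le_mul (hd v) h4
    _ = d * ∑ v ∈ T.image G, (S.filter fun x => G x = v).card := (Finset.mul_sum _ _ _).symm
    _ ≤ d * S.card := by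
        rw [Finset.sum_card_fiberwise_eq_card_filter]
        exact Nat.mul_le_mul_left _ (Finset.card_filter_le _ _)

theorem card_le_of_forall_eval_eq_zero {F : Type*} [Field F] [Fintype F] [DecidableEq F]
    {P : F[X]} (hP : P ≠ 0) {d : ℕ} (hd : P.natDegree ≤ d) {T : Finset F}
    (hT : ∀ x ∈ T, P.eval x = 0) : T.card ≤ d := by
  refine (Finset.card_le_card (t := P.roots.toFinset) ?_).trans
    ((Multiset.toFinset_card_le _).trans ((card_roots' _).trans hd))
  intro x hx
  simpa [hP] using hT x hx

theorem card_filter_pow_mul_eval_geom_le {F : Type*} [Field F] [Fintype F] [DecidableEq F]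
    {k : ℕ} {B c : F} (hB : B ≠ 0) (hc : c ≠ 0) {S : Finset F}
    (hG : Set.InjOn (fun x => B * x⁻¹ + c * x ^ k) {x | x ≠ 0 ∧ x ∉ S}) :
    (Finset.univ.filter fun z : Fˣ × F => (z.1 : F) ^ (k + 1) *
      (X * ∑ i ∈ Finset.range k, X ^ i : F[X]).eval z.2 = B / c).card ≤
      (k + 1) + (k + 1) * S.card := by
  set H : F[X] := X * ∑ i ∈ Finset.range k, X ^ i with hH
  have hgeom (t : F) : H.eval t * (t - 1) = t * (t ^ k - 1) := by
    rw [hH, eval_mul, eval_X, eval_geom_sum, mul_assoc, geom_sum_mul]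
  have hb : B / c ≠ 0 := div_ne_zero hB hc
  have hdeg (P Q R : F) (hR : R ≠ 0) :
      (C P * X ^ (k + 1) - C Q * X + C R : F[X]) ≠ 0 ∧
      (C P * X ^ (k + 1) - C Q * X + C R : F[X]).natDegree ≤ k + 1 := by
    refine ⟨fun h => hR (by simpa using congrArg (eval 0) h), ?_⟩
    compute_degree
  rw [← Finset.card_filter_add_card_filter_not (fun z : Fˣ × F => z.2 = 1)]
  refine Nat.add_le_add ?_ ?_
  · obtain ⟨h1, h2⟩ := hdeg (H.eval 1) 0 (-(B / c)) (neg_ne_zero.2 hb)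
    rw [← Finset.card_image_of_injOn (f := fun z : Fˣ × F => (z.1 : F))]
    · refine card_le_of_forall_eval_eq_zero h1 h2 fun x hx => ?_
      simp only [Finset.mem_image, Finset.mem_filter, Finset.mem_univ, true_and] at hx
      obtain ⟨⟨y, t⟩, ⟨h3, rfl⟩, rfl⟩ := hx
      simp only [eval_add, eval_sub, eval_mul, eval_C, eval_pow, eval_X]
      linear_combination h3
    · rintro ⟨x, t⟩ hx ⟨y, u⟩ hy hxy
      simp only [Finset.coe_filter, Finset.mem_filter, Set.mem_ofPred_eq] at hx hy
      exact Prod.ext (Units.ext hxy) (hx.2.trans hy.2.symm)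
  · refine le_trans ?_ (card_offDiag_filter_eq_le (G := fun x => B * x⁻¹ + c * x ^ k)
      (T := Finset.univ.filter fun x : F => x ≠ 0) (S := S) ?_ ?_)
    · refine Finset.card_le_card_of_injOn (fun z : Fˣ × F => ((z.1 : F), z.2 * z.1)) ?_ ?_
      · rintro ⟨x, t⟩ hz
        simp only [Finset.coe_filter, Finset.mem_filter, Finset.mem_univ, true_and,
          Set.mem_ofPred_eq] at hz
        obtain ⟨h1, h2⟩ := hz
        have hx : (x : F) ≠ 0 := x.ne_zero
        have ht : t ≠ 0 := by
          rintro rfl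
          rw [hH, eval_mul, eval_X, zero_mul, mul_zero] at h1
          exact hb h1.symm
        have h3 := hgeom t
        have h4 : c * ((x : F) ^ (k + 1) * (t * (t ^ k - 1))) = B * (t - 1) := by
          rw [← h3, ← mul_assoc _ _ (t - 1), h1]
          field_simp
        simp only [Finset.coe_filter, Finset.mem_offDiag, Finset.mem_filter, Finset.mem_univ,
          true_and, Set.mem_ofPred_eq]
        refine ⟨⟨hx, mul_ne_zero ht hx, fun h => h2 ?_⟩, ?_⟩
        · exact (mul_right_cancel₀ hx (by rw [one_mul]; exact h)).symm
        · rw [mul_pow]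
          field_simp
          linear_combination -h4
      · rintro ⟨x, t⟩ - ⟨y, u⟩ - hxy
        simp only [Prod.mk.injEq] at hxy
        obtain ⟨h1, h2⟩ := hxy
        obtain rfl := Units.ext h1
        exact Prod.ext rfl (mul_right_cancel₀ x.ne_zero h2)
    · intro x hx y hy hxy
      simp only [Finset.coe_sdiff, Finset.coe_filter, Finset.mem_univ, true_and, Set.mem_sdiff,
        Set.mem_ofPred_eq, Finset.mem_coe] at hx hy
      exact hG hx hy hxy
    · intro v
      obtain ⟨h1, h2⟩ := hdeg c v B hB
      refine card_le_of_forall_eval_eq_zero h1 h2 fun x hx => ?_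
      simp only [Finset.mem_filter, Finset.mem_univ, true_and] at hx
      obtain ⟨hx, rfl⟩ := hx
      simp only [eval_add, eval_sub, eval_mul, eval_C, eval_pow, eval_X]
      field_simp
      ring

theorem carlitzAlpha_mul_carlitzBeta_sub_ne_zero {F : Type*} [Field F] {a : ℕ → F} (h0 : a 0 ≠ 0)
    (n : ℕ) : carlitzAlpha a (n + 1) * carlitzBeta a n - carlitzAlpha a n * carlitzBeta a (n + 1) ≠
      0 := by
  induction n with
  | zero => simpa [carlitzAlpha, carlitzBeta] using h0
  | succ n ih =>
    rw [carlitzAlpha, carlitzBeta]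
    contrapose! ih
    linear_combination -ih

theorem carlitzMap_mul_eq {F : Type*} [Field F] [Fintype F] {q : ℕ} (hq : Fintype.card F = q)
    (hq3 : 3 ≤ q) (a : ℕ → F) {n : ℕ} {x : F}
    (hx : ∀ i, 1 ≤ i → i ≤ n → carlitzAlpha a i * x + carlitzBeta a i ≠ 0) :
    carlitzMap q a n x * (carlitzAlpha a n * x + carlitzBeta a n) =
      carlitzAlpha a (n + 1) * x + carlitzBeta a (n + 1) := by
  have hinv (y : F) (hy : y ≠ 0) : y ^ (q - 2) * y = 1 := by
    rw [← pow_succ, show q - 2 + 1 = q - 1 by omega, ← hq, FiniteField.pow_card_sub_one_eq_one y hy]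
  induction n with
  | zero => simp [carlitzMap, carlitzAlpha, carlitzBeta]
  | succ n ih =>
    have h1 := ih fun i hi hin => hx i hi (by omega)
    have h2 := hx (n + 1) (by omega) le_rfl
    have h3 : carlitzMap q a n x ≠ 0 := by
      intro h
      rw [h, zero_mul] at h1
      exact h2 h1.symm
    have h4 := hinv _ h3
    rw [carlitzMap, carlitzAlpha, carlitzBeta, ← h1]
    linear_combination (carlitzAlpha a n * x + carlitzBeta a n) * h4 +
      a (n + 2) * h1

theorem MemL2.exists_eq_add_mul_inv {F : Type*} [Field F] [Fintype F] {q n : ℕ}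
    (hq : Fintype.card F = q) (hq3 : 3 ≤ q) {f : F → F} (hf : MemL2 q f n) :
    ∃ A B : F, B ≠ 0 ∧ ∃ S : Finset F, S.card ≤ n ∧ ∀ x ≠ 0, x ∉ S → f x = A + B * x⁻¹ := by
  classical
  obtain ⟨-, -, a, ⟨h0, -, hrep⟩, hα, hβ⟩ := hf
  have hdet := carlitzAlpha_mul_carlitzBeta_sub_ne_zero h0
  have hβ' : carlitzBeta a (n + 1) ≠ 0 := by
    intro h
    exact hdet n (by rw [h, hβ, mul_zero, mul_zero, sub_zero])
  refine ⟨carlitzAlpha a (n + 1) / carlitzAlpha a n, carlitzBeta a (n + 1) / carlitzAlpha a n,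
    div_ne_zero hβ' hα, (Finset.Icc 1 n).image fun i => -carlitzBeta a i / carlitzAlpha a i,
    Finset.card_image_le.trans (by simp), fun x hx0 hxS => ?_⟩
  have h1 := carlitzMap_mul_eq hq hq3 a (n := n) (x := x) fun i hi hin h => by
    by_cases hi0 : carlitzAlpha a i = 0
    · rw [hi0, zero_mul, zero_add] at h
      exact hdet i (by rw [hi0, h, mul_zero, zero_mul, sub_zero])
    · refine hxS (Finset.mem_image.2 ⟨i, Finset.mem_Icc.2 ⟨hi, hin⟩, ?_⟩)
      rw [div_eq_iff hi0]
      linear_combination -h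
  rw [← hrep, hβ, add_zero] at h1
  field_simp
  linear_combination h1

end

theorem difference_monomial_case
    {F : Type*} [Field F] [Fintype F] (q n k : ℕ)
    (hq : Fintype.card F = q) (hq3 : 3 ≤ q)
    (f : F → F) (c : F) (hc : c ≠ 0)
    (hf : Function.Bijective f)
    (hfg : Function.Bijective fun x => f x + c * x ^ k)
    (hn1 : 1 ≤ n) (hL2 : MemL2 q f n)
    (hk1 : 1 ≤ k) (hk2 : k < q - 1) :
    (k : ℝ) * ((n : ℝ) + 3) +
      ((k : ℝ) - 1) * ((Nat.gcd (k + 1) (q - 1) : ℝ) - 1) * Real.sqrt q ≥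
      (q : ℝ) - (n : ℝ) := by
  classical
  subst hq
  obtain ⟨A, B, hB, S, hSn, hS⟩ := hL2.exists_eq_add_mul_inv rfl hq3
  have hinj : Set.InjOn (fun x => B * x⁻¹ + c * x ^ k) {x | x ≠ 0 ∧ x ∉ S} := by
    intro x hx y hy hxy
    apply hfg.injective
    change f x + c * x ^ k = f y + c * y ^ k
    rw [hS x hx.1 hx.2, hS y hy.1 hy.2, add_assoc, add_assoc]
    exact congrArg (A + ·) hxy
  have h1 := card_filter_pow_mul_eval_geom_le hB hc hinj
  have hmonic := Polynomial.monic_geom_sum_X (R := F) (n := k) (by omega)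
  have hdeg : (Polynomial.X * ∑ i ∈ Finset.range k, Polynomial.X ^ i :
      Polynomial F).natDegree = k := by
    rw [Polynomial.natDegree_X_mul hmonic.ne_zero]
    have h2 := congrArg Polynomial.natDegree (geom_sum_mul (Polynomial.X : Polynomial F) k)
    rw [← Polynomial.C_1, hmonic.natDegree_mul (Polynomial.monic_X_sub_C 1),
      Polynomial.natDegree_X_pow_sub_C, Polynomial.natDegree_X_sub_C] at h2
    exact h2
  have h2 := le_card_filter_pow_mul_eval_eq hmonic (by
    rw [Polynomial.eval_geom_sum, zero_geom_sum, if_neg (by omega)]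
    exact one_ne_zero) hdeg rfl (div_ne_zero hB hc)
  have h3 := h2.trans (Nat.cast_le.2 (h1.trans
    (Nat.add_le_add_left (Nat.mul_le_mul_left (k + 1) hSn) (k + 1))))
  push_cast at h3
  have hk : (1 : ℝ) ≤ k := by exact_mod_cast hk1
  nlinarith
end

section
/- Let q = p^r ≥ 3 be a prime power. Let f(x) and f(x) + c·x^k be permutation polynomials of F_q, where Crk(f) = n ≥ 1, f ∈ L₂, 1 ≤ k < q − 1, and c ∈ F_q*. If gcd(k+1, q−1) = 1, then k ≥ (q − n)/(n + 3). -/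
theorem carlitzMap_eq_div {F : Type*} [Field F] [Fintype F] {q : ℕ}
    (hq : Fintype.card F = q) (hq3 : 3 ≤ q) (a : ℕ → F) (x : F) (n : ℕ)
    (hx : ∀ i, 1 ≤ i → i ≤ n → carlitzAlpha a i * x + carlitzBeta a i ≠ 0) :
    carlitzMap q a n x = (carlitzAlpha a (n + 1) * x + carlitzBeta a (n + 1)) /
      (carlitzAlpha a n * x + carlitzBeta a n) := by
  have hinv (z : F) : z ^ (q - 2) = z⁻¹ := by
    rcases eq_or_ne z 0 with rfl | hz
    · rw [zero_pow (by omega), inv_zero]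
    · refine eq_inv_of_mul_eq_one_left ?_
      rw [← pow_succ, show q - 2 + 1 = q - 1 by omega, ← hq]
      exact FiniteField.pow_card_sub_one_eq_one z hz
  induction n with
  | zero => simp [carlitzMap, carlitzAlpha, carlitzBeta]
  | succ n ih =>
    have hne := hx (n + 1) (by omega) le_rfl
    change carlitzMap q a n x ^ (q - 2) + a (n + 2) = _
    rw [ih fun i h1 h2 => hx i h1 (by omega), hinv, inv_div, carlitzAlpha,
      carlitzBeta, div_add' _ _ _ hne]
    ring

theorem carlitzAlpha_mul_carlitzBeta_ne {F : Type*} [Field F] (a : ℕ → F) (ha : a 0 ≠ 0)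
    (n : ℕ) :
    carlitzAlpha a (n + 1) * carlitzBeta a n ≠ carlitzAlpha a n * carlitzBeta a (n + 1) := by
  induction n with
  | zero => simpa [carlitzAlpha, carlitzBeta] using ha
  | succ n ih =>
    contrapose ih
    rw [carlitzAlpha, carlitzBeta] at ih
    linear_combination -ih

theorem card_collisions_le {α β : Type*} [DecidableEq α] [Fintype β] [DecidableEq β]
    (S P : Finset α) (h : α → β) (K : ℕ)
    (hinj : Set.InjOn h (S \ P : Finset α))
    (hK : ∀ y, (S.filter fun x => h x = y).card ≤ K) :
    (S.offDiag.filter fun z => h z.1 = h z.2).card ≤ K * P.card := by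
  rw [Finset.card_eq_sum_card_fiberwise (f := fun z => h z.1) (t := Finset.univ)
      (fun _ _ => Finset.mem_coe.2 (Finset.mem_univ _)),
    Finset.card_eq_sum_card_fiberwise (s := P) (f := h) (t := Finset.univ)
      (fun _ _ => Finset.mem_coe.2 (Finset.mem_univ _)), Finset.mul_sum]
  refine Finset.sum_le_sum fun y _ => ?_
  have hfib : ((S.offDiag.filter fun z => h z.1 = h z.2).filter fun z => h z.1 = y) =
      (S.filter fun x => h x = y).offDiag := by
    ext ⟨u, v⟩
    simp only [Finset.mem_filter, Finset.mem_offDiag]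
    grind
  have hrest : ((S \ P).filter fun x => h x = y).card ≤ 1 := by
    refine Finset.card_le_one.2 fun u hu v hv => ?_
    rw [Finset.mem_filter] at hu hv
    exact hinj hu.1 hv.1 (hu.2.trans hv.2.symm)
  have hsplit : (S.filter fun x => h x = y).card ≤ (P.filter fun x => h x = y).card + 1 := by
    have hsub : (S.filter fun x => h x = y) ⊆
        (P.filter fun x => h x = y) ∪ ((S \ P).filter fun x => h x = y) := by
      intro u
      simp only [Finset.mem_filter, Finset.mem_union, Finset.mem_sdiff]
      tauto
    have := (Finset.card_le_card hsub).trans (Finset.card_union_le _ _)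
    omega
  rw [hfib, Finset.offDiag_card]
  calc _ = (S.filter fun x => h x = y).card * ((S.filter fun x => h x = y).card - 1) := by
        rw [Nat.mul_sub, mul_one]
    _ ≤ _ := Nat.mul_le_mul (hK y) (by omega)

theorem exists_pow_eq_of_coprime {F : Type*} [Field F] [Fintype F] {m : ℕ}
    (hm : Nat.Coprime m (Fintype.card F - 1)) {z : F} (hz : z ≠ 0) :
    ∃ x : F, x ≠ 0 ∧ x ^ m = z := by
  have hcop : (Nat.card Fˣ).Coprime m := by
    rw [Nat.card_units, Nat.card_eq_fintype_card]
    exact hm.symm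
  obtain ⟨x, hx⟩ := (powCoprime hcop).surjective (Units.mk0 z hz)
  refine ⟨x, x.ne_zero, ?_⟩
  simpa using congrArg Units.val hx

theorem card_pow_eq_one_le {F : Type*} [Field F] [Fintype F] [DecidableEq F] {k : ℕ}
    (hk : 1 ≤ k) : (Finset.univ.filter fun t : F => t ^ k = 1).card ≤ k := by
  have hsub : (Finset.univ.filter fun t : F => t ^ k = 1) ⊆
      (Polynomial.nthRoots k (1 : F)).toFinset := by
    intro t ht
    rw [Multiset.mem_toFinset, Polynomial.mem_nthRoots hk]
    simpa using ht
  exact (Finset.card_le_card hsub).trans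
    ((Multiset.toFinset_card_le _).trans (Polynomial.card_nthRoots k 1))

theorem card_fiber_inv_add_pow_le {F : Type*} [Field F] [Fintype F] [DecidableEq F] (k : ℕ)
    {B : F} (c : F) (hB : B ≠ 0) (y : F) :
    ((Finset.univ.erase 0).filter fun x : F => B * x⁻¹ + c * x ^ k = y).card ≤ k + 1 := by
  let p : Polynomial F := Polynomial.C c * Polynomial.X ^ (k + 1) -
    Polynomial.C y * Polynomial.X + Polynomial.C B
  have hp : p ≠ 0 := by
    intro h
    have := congrArg (Polynomial.eval 0) h
    simp [p, hB] at this
  have hdeg : p.natDegree ≤ k + 1 := by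
    simp only [p]
    compute_degree
  have hsub : ((Finset.univ.erase 0).filter fun x : F => B * x⁻¹ + c * x ^ k = y) ⊆
      p.roots.toFinset := by
    intro x hx
    simp only [Finset.mem_filter, Finset.mem_erase, Finset.mem_univ, and_true] at hx
    rw [Multiset.mem_toFinset, Polynomial.mem_roots hp, Polynomial.IsRoot.def]
    simp only [p, Polynomial.eval_add, Polynomial.eval_sub, Polynomial.eval_mul,
      Polynomial.eval_C, Polynomial.eval_pow, Polynomial.eval_X]
    obtain ⟨hx0, hxy⟩ := hx
    rw [← hxy]
    field_simp
    ring
  exact (Finset.card_le_card hsub).trans ((Multiset.toFinset_card_le _).trans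
    ((Polynomial.card_roots' p).trans hdeg))

theorem le_card_collisions_inv_add_pow {F : Type*} [Field F] [Fintype F] [DecidableEq F]
    {k : ℕ} (hk : 1 ≤ k) (hm : Nat.Coprime (k + 1) (Fintype.card F - 1)) {B c : F}
    (hB : B ≠ 0) (hc : c ≠ 0) :
    Fintype.card F - 1 - k ≤ (((Finset.univ.erase (0 : F)).offDiag).filter fun z =>
      B * z.1⁻¹ + c * z.1 ^ k = B * z.2⁻¹ + c * z.2 ^ k).card := by
  let T : Finset F := Finset.univ.erase 0 \ Finset.univ.filter fun t : F => t ^ k = 1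
  have hT : Fintype.card F - 1 - k ≤ T.card := by
    have h1 := Finset.le_card_sdiff (Finset.univ.filter fun t : F => t ^ k = 1)
      (Finset.univ.erase (0 : F))
    rw [Finset.card_erase_of_mem (Finset.mem_univ _), Finset.card_univ] at h1
    have h2 := card_pow_eq_one_le (F := F) hk
    exact le_trans (by omega) h1
  have hex (t : F) (ht : t ∈ T) : ∃ x : F, x ≠ 0 ∧
      x ^ (k + 1) = B * (1 - t) / (c * t * (1 - t ^ k)) := by
    simp only [T, Finset.mem_sdiff, Finset.mem_erase, Finset.mem_filter, Finset.mem_univ,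
      and_true, true_and] at ht
    have h1 : 1 - t ≠ 0 := sub_ne_zero.2 fun h => ht.2 (by rw [← h, one_pow])
    have h2 : 1 - t ^ k ≠ 0 := sub_ne_zero.2 (Ne.symm ht.2)
    exact exists_pow_eq_of_coprime hm
      (div_ne_zero (mul_ne_zero hB h1) (mul_ne_zero (mul_ne_zero hc ht.1) h2))
  choose! x hx0 hx using hex
  refine hT.trans (Finset.card_le_card_of_injOn (fun t => (x t, t * x t)) ?_ ?_)
  · intro t ht
    have hxt := hx t ht
    have hxt0 := hx0 t ht
    simp only [T, Finset.coe_sdiff, Set.mem_sdiff, Finset.mem_coe, Finset.mem_erase,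
      Finset.mem_filter, Finset.mem_univ, and_true, true_and] at ht
    have ht1 : t ≠ 1 := fun h => ht.2 (by rw [h, one_pow])
    have h2 : 1 - t ^ k ≠ 0 := sub_ne_zero.2 (Ne.symm ht.2)
    have ht0 := ht.1
    simp only [Finset.coe_filter, Set.mem_ofPred_eq, Finset.mem_offDiag, Finset.mem_erase,
      Finset.mem_univ, and_true]
    refine ⟨⟨hxt0, mul_ne_zero ht0 hxt0, fun h => ht1 ?_⟩, ?_⟩
    · exact mul_right_cancel₀ hxt0 (by rw [← h, one_mul])
    · rw [eq_div_iff (mul_ne_zero (mul_ne_zero hc ht0) h2)] at hxt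
      rw [mul_pow]
      field_simp
      linear_combination hxt
  · intro s hs t ht hst
    simp only [Prod.mk.injEq] at hst
    rw [hst.1] at hst
    exact mul_right_cancel₀ (hx0 t ht) hst.2

theorem difference_monomial_case_coprime
    {F : Type*} [Field F] [Fintype F] (q n k : ℕ)
    (hq : Fintype.card F = q) (hq3 : 3 ≤ q)
    (f : F → F) (c : F) (hc : c ≠ 0)
    (hf : Function.Bijective f)
    (hfg : Function.Bijective fun x => f x + c * x ^ k)
    (hn1 : 1 ≤ n) (hL2 : MemL2 q f n)
    (hk1 : 1 ≤ k) (hk2 : k < q - 1)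
    (hm : Nat.gcd (k + 1) (q - 1) = 1) :
    (k : ℝ) ≥ ((q : ℝ) - (n : ℝ)) / ((n : ℝ) + 3) := by
  classical
  obtain ⟨-, -, a, ⟨ha0, -, hrep⟩, hα, hβ⟩ := hL2
  obtain ⟨m, rfl⟩ : ∃ m, n = m + 1 := ⟨n - 1, by omega⟩
  have hdet := carlitzAlpha_mul_carlitzBeta_ne a ha0
  have hβ' : carlitzBeta a (m + 2) ≠ 0 := fun h => hdet (m + 1) (by rw [hβ, h]; ring)
  let A := carlitzAlpha a (m + 2) / carlitzAlpha a (m + 1)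
  let B := carlitzBeta a (m + 2) / carlitzAlpha a (m + 1)
  have hB : B ≠ 0 := div_ne_zero hβ' hα
  let P : Finset F := (Finset.Icc 1 m).image fun i => -carlitzBeta a i / carlitzAlpha a i
  have hPcard : P.card ≤ m := by
    simpa using (Finset.card_image_le : P.card ≤ (Finset.Icc 1 m).card)
  have hfx (x : F) (hx : x ∈ Finset.univ.erase 0 \ P) : f x = A + B * x⁻¹ := by
    rw [Finset.mem_sdiff] at hx
    have hx0 : x ≠ 0 := Finset.ne_of_mem_erase hx.1
    rw [hrep, carlitzMap_eq_div hq hq3, hβ]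
    · simp only [A, B]
      field_simp
      ring
    · intro i hi1 hi2 hi
      rcases hi2.eq_or_lt with rfl | hlt
      · rw [hβ, add_zero] at hi
        exact mul_ne_zero hα hx0 hi
      · refine hx.2 (Finset.mem_image.2 ⟨i, Finset.mem_Icc.2 ⟨hi1, by omega⟩, ?_⟩)
        have hαi : carlitzAlpha a i ≠ 0 := by
          intro h
          have hβi : carlitzBeta a i = 0 := by simpa [h] using hi
          exact hdet i (by rw [h, hβi]; ring)
        rw [div_eq_iff hαi]
        linear_combination -hi
  have hinj : Set.InjOn (fun x => B * x⁻¹ + c * x ^ k)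
      (Finset.univ.erase 0 \ P : Finset F) := by
    intro x hx y hy hxy
    apply hfg.injective
    simp only at hxy ⊢
    rw [hfx x hx, hfx y hy]
    linear_combination hxy
  have hupper := card_collisions_le _ P _ (k + 1) hinj
    (card_fiber_inv_add_pow_le k c hB)
  have hlower := le_card_collisions_inv_add_pow hk1 (by rw [hq]; exact hm) hB hc
  rw [hq] at hlower
  have hle : q - 1 - k ≤ (k + 1) * m :=
    (hlower.trans hupper).trans (Nat.mul_le_mul le_rfl hPcard)
  have hqle : (q : ℝ) ≤ (k + 1) * m + k + 1 := by
    exact_mod_cast (by omega : q ≤ (k + 1) * m + k + 1)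
  rw [ge_iff_le, div_le_iff₀ (by positivity)]
  push_cast
  nlinarith [Nat.cast_nonneg (α := ℝ) k]
end

section
/- Let q ≥ 3 be a prime power, and let f : F_q → F_q be a bijection and g ∈ F_q[x] a polynomial of degree k ≥ 1 such that x ↦ f(x) + g(x) is also a bijection of F_q. Suppose there exist a, b, d ∈ F_q with ad − b ≠ 0 and a subset S ⊆ F_q ∪ {∞} with −d ∈ S such that f(z) = (az + b)/(z + d) for all z ∈ F_q \ S. Define H : F_q* → F_q by H(x) = (a·x − (ad − b))/x + g(x − d), and let μ = |{(x, y) ∈ F_q* × F_q* : x ≠ y and H(x) = H(y)}|. Then |S| ≥ 1 + μ/(k + 1). -/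
open OnePoint

/-- A function of the form `x ↦ (a * x - e) / x + g (x - d)` with `e ≠ 0` takes each value at most
`g.natDegree + 1` times on nonzero arguments. -/
lemma card_fiber_le_natDegree_add_one {F : Type*} [Field F] (g : Polynomial F) (a d e c : F)
    (he : e ≠ 0) (A : Finset F)
    (hA : ∀ x ∈ A, x ≠ 0 ∧ (a * x - e) / x + g.eval (x - d) = c) :
    A.card ≤ g.natDegree + 1 := by
  let p : Polynomial F := Polynomial.X * g.comp (Polynomial.X - Polynomial.C d) +
    (Polynomial.C (a - c) * Polynomial.X - Polynomial.C e)
  have hp : p ≠ 0 := by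
    intro h
    have h0 : p.eval 0 = 0 := by rw [h, Polynomial.eval_zero]
    simp [p, he] at h0
  have hdeg : p.natDegree ≤ g.natDegree + 1 := by
    refine Polynomial.natDegree_add_le_of_degree_le ?_ ?_
    · refine Polynomial.natDegree_mul_le.trans ?_
      rw [Polynomial.natDegree_comp, Polynomial.natDegree_X_sub_C, Polynomial.natDegree_X]
      omega
    · rw [sub_eq_add_neg, ← Polynomial.C_neg]
      exact Polynomial.natDegree_linear_le.trans (by omega)
  refine (Polynomial.card_le_degree_of_subset_roots (p := p) ?_).trans hdeg
  intro x hx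
  obtain ⟨hx0, hxc⟩ := hA x hx
  rw [Polynomial.mem_roots hp, Polynomial.IsRoot.def]
  have hx' : a * x - e + g.eval (x - d) * x = c * x := by
    rw [← hxc]
    field_simp
  simp only [p, Polynomial.eval_add, Polynomial.eval_mul, Polynomial.eval_X, Polynomial.eval_comp,
    Polynomial.eval_sub, Polynomial.eval_C]
  linear_combination hx'

/-- If all fibers of `H` on `N` have at most `n` elements and `H` is injective on `N \ T`, then `H`
has at most `n * #T` ordered collisions on `N`. -/
lemma card_collisions_le_mul_card {α β : Type*} [DecidableEq α] [DecidableEq β]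
    (N T : Finset α) (H : α → β) (n : ℕ) (hT : T ⊆ N)
    (hn : ∀ c, (N.filter (fun x => H x = c)).card ≤ n)
    (hinj : ∀ x ∈ N, ∀ y ∈ N, x ∉ T → y ∉ T → H x = H y → x = y) :
    (N.offDiag.filter (fun p => H p.1 = H p.2)).card ≤ n * T.card := by
  have hcover : N.offDiag.filter (fun p => H p.1 = H p.2) ⊆
      (N.image H).biUnion (fun c => (N.filter (fun x => H x = c)).offDiag) := by
    rintro ⟨x, y⟩ hp
    simp only [Finset.mem_filter, Finset.mem_offDiag] at hp
    obtain ⟨⟨hx, hy, hxy⟩, h⟩ := hp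
    simp only [Finset.mem_biUnion, Finset.mem_offDiag, Finset.mem_filter]
    exact ⟨H x, Finset.mem_image_of_mem H hx, ⟨hx, rfl⟩, ⟨hy, h.symm⟩, hxy⟩
  have hfiber : ∀ c, (N.filter (fun x => H x = c)).offDiag.card ≤
      n * (T.filter (fun x => H x = c)).card := by
    intro c
    have hdiff : (N.filter (fun x => H x = c) \ T.filter (fun x => H x = c)).card ≤ 1 := by
      rw [Finset.card_le_one]
      intro x hx y hy
      simp only [Finset.mem_sdiff, Finset.mem_filter] at hx hy
      exact hinj x hx.1.1 y hy.1.1 (fun h => hx.2 ⟨h, hx.1.2⟩) (fun h => hy.2 ⟨h, hy.1.2⟩)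
        (hx.1.2.trans hy.1.2.symm)
    have hsub := Finset.card_sdiff_add_card_eq_card
      (Finset.filter_subset_filter (fun x => H x = c) hT)
    rw [Finset.offDiag_card, ← Nat.mul_sub_one]
    exact Nat.mul_le_mul (hn c) (by omega)
  calc _ ≤ _ := Finset.card_le_card hcover
    _ ≤ ∑ c ∈ N.image H, (N.filter (fun x => H x = c)).offDiag.card := Finset.card_biUnion_le
    _ ≤ ∑ c ∈ N.image H, n * (T.filter (fun x => H x = c)).card :=
        Finset.sum_le_sum fun c _ => hfiber c
    _ = n * T.card := by
        rw [← Finset.mul_sum, ← Finset.card_eq_sum_card_fiberwise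
          (fun x hx => Finset.mem_image_of_mem H (hT hx))]

theorem pole_set_bound_from_collisions
    {F : Type*} [Field F] [Fintype F] (q k : ℕ)
    (hq : Fintype.card F = q) (hq3 : 3 ≤ q)
    (f : F → F) (g : Polynomial F)
    (hf : Function.Bijective f)
    (hfg : Function.Bijective fun x => f x + g.eval x)
    (hk1 : 1 ≤ k) (hdeg : g.natDegree = k)
    (a b d : F) (habd : a * d - b ≠ 0)
    (S : Finset (OnePoint F)) (hdS : ((-d : F) : OnePoint F) ∈ S)
    (hfS : ∀ z : F, ((z : OnePoint F) ∉ S) → f z = (a * z + b) / (z + d))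
    (H : F → F)
    (hH : ∀ x : F, x ≠ 0 → H x = (a * x - (a * d - b)) / x + g.eval (x - d))
    (μ : ℕ)
    (hμ : μ = {p : F × F | p.1 ≠ 0 ∧ p.2 ≠ 0 ∧ p.1 ≠ p.2 ∧ H p.1 = H p.2}.ncard) :
    (S.card : ℝ) ≥ 1 + (μ : ℝ) / ((k : ℝ) + 1) := by
  classical
  let N : Finset F := Finset.univ.filter (fun x => x ≠ 0)
  let T : Finset F := N.filter (fun x => ((x - d : F) : OnePoint F) ∈ S)
  have hcard : T.card + 1 ≤ S.card := by
    have hmaps : T.card ≤ (S.erase ((-d : F) : OnePoint F)).card := by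
      refine Finset.card_le_card_of_injOn (fun x => ((x - d : F) : OnePoint F)) ?_ ?_
      · intro x hx
        simp only [T, N, Finset.coe_filter, Finset.mem_filter, Finset.mem_univ, true_and,
          Set.mem_ofPred_eq] at hx
        refine Finset.mem_coe.mpr (Finset.mem_erase.mpr ⟨fun h => hx.1 ?_, hx.2⟩)
        linear_combination OnePoint.coe_injective h
      · intro x _ y _ h
        linear_combination OnePoint.coe_injective h
    have := Finset.card_erase_add_one hdS
    omega
  have hgood : ∀ x ∈ N, x ∉ T → H x = f (x - d) + g.eval (x - d) := by
    intro x hxN hxT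
    have hx : x ≠ 0 := (Finset.mem_filter.mp hxN).2
    rw [hH x hx, hfS (x - d) fun h => hxT (Finset.mem_filter.mpr ⟨hxN, h⟩), sub_add_cancel]
    congr 2
    ring
  have hcoll := card_collisions_le_mul_card N T H (k + 1) (Finset.filter_subset _ _)
    (fun c => by
      rw [← hdeg]
      refine card_fiber_le_natDegree_add_one g a d (a * d - b) c habd _ fun x hx => ?_
      simp only [N, Finset.mem_filter, Finset.mem_univ, true_and] at hx
      exact ⟨hx.1, (hH x hx.1).symm.trans hx.2⟩)
    (fun x hx y hy hxT hyT h => by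
      rw [hgood x hx hxT, hgood y hy hyT] at h
      exact sub_left_injective (hfg.injective h))
  have hμle : μ ≤ (k + 1) * T.card := by
    rw [hμ]
    refine le_of_eq_of_le ?_ hcoll
    rw [← Set.ncard_coe_finset]
    congr 1
    ext p
    simp [N, and_assoc]
  have hdiv : (μ : ℝ) / ((k : ℝ) + 1) ≤ T.card := by
    rw [div_le_iff₀ (by positivity), mul_comm]
    exact_mod_cast hμle
  have hcard' : (T.card : ℝ) + 1 ≤ S.card := by exact_mod_cast hcard
  linarith
end

section
/- Let q be a prime power, b̃ ∈ F_q*, and h ∈ F_q[x] a polynomial of degree k ≥ 1. Let Φ(x, y) ∈ F_q[x, y] be the bivariate polynomial Φ(x, y) = x·y·((h(x) − h(y))/(x − y)) + b̃, where (h(x) − h(y))/(x − y) is the polynomial quotient of h(x) − h(y) by x − y. Then Φ has a factor in F_q[x, y] that is irreducible over the algebraic closure of F_q (i.e., Φ has an absolutely irreducible factor defined over F_q). -/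
open MvPolynomial

/-- Substituting a variable into a univariate polynomial gives leading exponent
`natDegree` in that variable. -/
lemma MonomialOrder.degree_aeval_X {σ K : Type*} [Field K] (m : MonomialOrder σ) (i : σ)
    (p : Polynomial K) :
    m.degree (Polynomial.aeval (X i : MvPolynomial σ K) p) = Finsupp.single i p.natDegree := by
  induction hn : p.natDegree generalizing p with
  | zero =>
    rw [Polynomial.eq_C_of_natDegree_eq_zero hn, Polynomial.aeval_C, algebraMap_eq, m.degree_C,
      Finsupp.single_zero]
  | succ n ih =>
    have hdeg : p.divX.natDegree = n := by
      rw [Polynomial.natDegree_divX_eq_natDegree_tsub_one, hn, Nat.add_sub_cancel]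
    have hne : p.divX ≠ 0 := by
      intro h0
      have := Polynomial.divX_eq_zero_iff.1 h0
      rw [this, Polynomial.natDegree_C] at hn
      omega
    have hne' : Polynomial.aeval (X i : MvPolynomial σ K) p.divX ≠ 0 := fun h0 =>
      hne ((transcendental_iff.1 (transcendental_X K i)) _ h0)
    have hmul : m.degree (Polynomial.aeval (X i : MvPolynomial σ K) p.divX * X i) =
        Finsupp.single i (n + 1) := by
      rw [m.degree_mul hne' (X_ne_zero i), ih _ hdeg, m.degree_X, ← Finsupp.single_add]
    conv_lhs => rw [← p.divX_mul_X_add]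
    rw [map_add, map_mul, Polynomial.aeval_X, Polynomial.aeval_C, algebraMap_eq,
      m.degree_add_of_lt, hmul]
    rw [hmul, m.degree_C, map_zero, m.toSyn_lt_iff_ne_zero, ne_eq, m.toSyn_eq_zero_iff,
      Finsupp.single_eq_zero]
    exact n.succ_ne_zero

lemma MonomialOrder.degree_map_of_injective {σ R S : Type*} [CommSemiring R] [CommSemiring S]
    (m : MonomialOrder σ) {f : R →+* S} (hf : Function.Injective f) (p : MvPolynomial σ R) :
    m.degree (map f p) = m.degree p := by
  unfold MonomialOrder.degree
  rw [support_map_of_injective p hf]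

/-- A polynomial fixed by the whole Galois group has coefficients in the base field. -/
lemma MvPolynomial.mem_range_map_algebraMap_of_fixed {σ F K : Type*} [Field F] [Field K]
    [Algebra F K] [IsGalois F K] (p : MvPolynomial σ K)
    (hp : ∀ g : K ≃ₐ[F] K, map (g : K →+* K) p = p) :
    ∃ p₀ : MvPolynomial σ F, map (algebraMap F K) p₀ = p := by
  refine mem_range_map_iff_coeffs_subset.2 fun c hc => ?_
  obtain ⟨d, -, rfl⟩ := mem_coeffs_iff.1 hc
  refine (InfiniteGalois.mem_range_algebraMap_iff_fixed _).2 fun g => ?_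
  conv_rhs => rw [← hp g, coeff_map]
  rfl

/-- A polynomial whose leading exponent involves the variable `i` has an irreducible factor with
the same property. -/
lemma MonomialOrder.exists_irreducible_dvd_degree_apply_ne_zero {σ K : Type*} [Field K]
    (m : MonomialOrder σ) (i : σ) (f : MvPolynomial σ K) (hf : m.degree f i ≠ 0) :
    ∃ P, Irreducible P ∧ P ∣ f ∧ m.degree P i ≠ 0 := by
  induction f using WfDvdMonoid.induction_on_irreducible with
  | zero => simp at hf
  | unit u hu =>
    obtain ⟨c, -, rfl⟩ := MvPolynomial.isUnit_iff_eq_C_of_isReduced.1 hu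
    simp [m.degree_C] at hf
  | mul a P ha hP ih =>
    rw [m.degree_mul hP.ne_zero ha, Finsupp.add_apply] at hf
    by_cases h0 : m.degree P i = 0
    · obtain ⟨P', h1, h2, h3⟩ := ih (by omega)
      exact ⟨P', h1, h2.mul_left P, h3⟩
    · exact ⟨P, hP, dvd_mul_right P a, h0⟩

/-- A polynomial over `F` whose leading exponent is linear in the variable `i` has an absolutely
irreducible factor over `F`. -/
lemma MonomialOrder.exists_dvd_irreducible_map_of_degree_apply_eq_one {σ F K : Type*} [Field F]
    [Field K] [Algebra F K] [IsGalois F K] (m : MonomialOrder σ) (i : σ) (f : MvPolynomial σ F)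
    (hf : m.degree f i = 1) :
    ∃ p, p ∣ f ∧ Irreducible (map (algebraMap F K) p) := by
  have hinj : Function.Injective (map (σ := σ) (algebraMap F K)) :=
    map_injective _ (algebraMap F K).injective
  have hf' : m.degree (map (algebraMap F K) f) i = 1 := by
    rw [m.degree_map_of_injective (algebraMap F K).injective, hf]
  have hf0 : map (algebraMap F K) f ≠ 0 := by
    intro h0
    simp [h0] at hf'
  obtain ⟨P', hP', hdvd', hi'⟩ := m.exists_irreducible_dvd_degree_apply_ne_zero i _
    (by rw [hf']; exact one_ne_zero)
  have hlc : m.leadingCoeff P' ≠ 0 := m.leadingCoeff_ne_zero_iff.2 hP'.ne_zero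
  have hCne : (C (m.leadingCoeff P')⁻¹ : MvPolynomial σ K) ≠ 0 := by
    simpa using hlc
  have hunit : IsUnit (C (m.leadingCoeff P')⁻¹ : MvPolynomial σ K) :=
    (IsUnit.mk0 _ (inv_ne_zero hlc)).map C
  obtain ⟨P, hP, hdvd, hi, hmonic⟩ : ∃ P, Irreducible P ∧ P ∣ map (algebraMap F K) f ∧
      m.degree P i ≠ 0 ∧ m.leadingCoeff P = 1 := by
    refine ⟨C (m.leadingCoeff P')⁻¹ * P', ?_, ?_, ?_, ?_⟩
    · exact (irreducible_isUnit_mul hunit).2 hP'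
    · exact (hunit.mul_left_dvd).2 hdvd'
    · rw [m.degree_mul hCne hP'.ne_zero, m.degree_C, zero_add]
      exact hi'
    · rw [m.leadingCoeff_mul, m.leadingCoeff_C, inv_mul_cancel₀ hlc]
  have hfix : ∀ g : K ≃ₐ[F] K,
      map (g : K →+* K) (map (algebraMap F K) f) = map (algebraMap F K) f := by
    intro g
    rw [map_map]
    congr 2
    ext x
    simp
  have hPfix : ∀ g : K ≃ₐ[F] K, map (g : K →+* K) P = P := by
    intro g
    have hginj : Function.Injective (g : K →+* K) := (g : K →+* K).injective
    have hgP : Irreducible (map (g : K →+* K) P) :=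
      (MulEquiv.irreducible_iff (mapEquiv σ (g : K ≃+* K))).2 hP
    have hgdeg : m.degree (map (g : K →+* K) P) = m.degree P :=
      m.degree_map_of_injective hginj P
    have hglc : m.leadingCoeff (map (g : K →+* K) P) = 1 := by
      rw [MonomialOrder.leadingCoeff, hgdeg, coeff_map]
      change (g : K →+* K) (m.leadingCoeff P) = 1
      rw [hmonic, map_one]
    have hgdvd : map (g : K →+* K) P ∣ map (algebraMap F K) f := by
      rw [← hfix g]
      exact _root_.map_dvd (map (g : K →+* K)) hdvd
    obtain ⟨R, hR⟩ := hgdvd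
    have hR0 : R ≠ 0 := by
      rintro rfl
      exact hf0 (by rw [hR, mul_zero])
    have hRi : m.degree R i = 0 := by
      rw [hR, m.degree_mul hgP.ne_zero hR0, Finsupp.add_apply, hgdeg] at hf'
      omega
    rcases hP.prime.dvd_or_dvd (hR ▸ hdvd) with h | ⟨S, rfl⟩
    · obtain ⟨u, hu⟩ := hP.associated_of_dvd hgP h
      obtain ⟨c, -, hc⟩ := MvPolynomial.isUnit_iff_eq_C_of_isReduced.1 u.isUnit
      rw [← hu, m.leadingCoeff_mul, hmonic, hc, m.leadingCoeff_C, one_mul] at hglc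
      rw [← hu, hc, hglc, C_1, mul_one]
    · rw [m.degree_mul hP.ne_zero (right_ne_zero_of_mul hR0), Finsupp.add_apply] at hRi
      omega
  obtain ⟨R, hR⟩ := hdvd
  have hRfix : ∀ g : K ≃ₐ[F] K, map (g : K →+* K) R = R := by
    intro g
    have h1 := hfix g
    rw [hR, map_mul, hPfix g] at h1
    exact mul_left_cancel₀ hP.ne_zero h1
  obtain ⟨p, rfl⟩ := mem_range_map_algebraMap_of_fixed P hPfix
  obtain ⟨r, rfl⟩ := mem_range_map_algebraMap_of_fixed R hRfix
  exact ⟨p, ⟨r, hinj (by rw [hR, map_mul])⟩, hP⟩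

theorem absolutely_irreducible_factor_exists
    {F : Type*} [Field F] [Fintype F]
    (btilde : F) (hb : btilde ≠ 0)
    (h : Polynomial F) (hdeg : 1 ≤ h.natDegree)
    (Q Φ : MvPolynomial (Fin 2) F)
    (hQ : (X 0 - X 1) * Q =
        Polynomial.aeval (X 0 : MvPolynomial (Fin 2) F) h -
        Polynomial.aeval (X 1 : MvPolynomial (Fin 2) F) h)
    (hΦ : Φ = X 0 * X 1 * Q + C btilde) :
    ∃ p : MvPolynomial (Fin 2) F, p ∣ Φ ∧
      Irreducible (MvPolynomial.map (algebraMap F (AlgebraicClosure F)) p) := by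
  let m : MonomialOrder (Fin 2) := MonomialOrder.lex
  refine m.exists_dvd_irreducible_map_of_degree_apply_eq_one 1 Φ ?_
  have hlt : ∀ n : ℕ, 1 ≤ n → m.toSyn (Finsupp.single 1 n) < m.toSyn (Finsupp.single 0 n) := by
    intro n hn
    refine MonomialOrder.lex_lt_iff.2 ⟨0, by simp, ?_⟩
    simpa using by omega
  have hnum : m.degree (Polynomial.aeval (X 0 : MvPolynomial (Fin 2) F) h -
      Polynomial.aeval (X 1 : MvPolynomial (Fin 2) F) h) = Finsupp.single 0 h.natDegree := by
    rw [m.degree_sub_of_lt, m.degree_aeval_X]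
    rw [m.degree_aeval_X, m.degree_aeval_X]
    exact hlt _ hdeg
  have hden : m.degree (X 0 - X 1 : MvPolynomial (Fin 2) F) = Finsupp.single 0 1 := by
    rw [m.degree_sub_of_lt, m.degree_X]
    rw [m.degree_X, m.degree_X]
    exact hlt 1 le_rfl
  have hprod : (X 0 - X 1) * Q ≠ 0 := by
    rw [hQ]
    refine m.ne_zero_of_degree_ne_zero ?_
    rw [hnum]
    simpa using by omega
  have hQ0 : Q ≠ 0 := right_ne_zero_of_mul hprod
  have hQdeg : m.degree Q 1 = 0 := by
    have := congrArg (fun d => d 1) (hnum ▸ hQ ▸ m.degree_mul (left_ne_zero_of_mul hprod) hQ0)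
    rw [hden] at this
    simpa using this.symm
  have hmul : m.degree (X 0 * X 1 * Q) = Finsupp.single 0 1 + Finsupp.single 1 1 + m.degree Q := by
    rw [m.degree_mul (mul_ne_zero (X_ne_zero 0) (X_ne_zero 1)) hQ0,
      m.degree_mul (X_ne_zero 0) (X_ne_zero 1), m.degree_X, m.degree_X]
  have hmul1 : m.degree (X 0 * X 1 * Q) 1 = 1 := by
    rw [hmul]
    simp [hQdeg]
  rw [hΦ, m.degree_add_of_lt, hmul1]
  rw [m.degree_C, map_zero, m.toSyn_lt_iff_ne_zero, ne_eq, m.toSyn_eq_zero_iff]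
  intro h0
  rw [h0] at hmul1
  exact zero_ne_one hmul1
end
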